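/- Fix ε1, ε2 ∈ (0,1), an integer c0 ≥ 2, and parameters τ ∈ (0,1/2), ω ∈ (0,1) with ω ≤ 2√(τ·c0). Set the cutoff t = τ/c0 and assume c0 ≥ 1/(τ·(3.4π)²). Define D = e·(ω/1.7)², δ = 2τ + πω + e^{1.7}·(π·c0/(ω·(1−D)))·D^{τ + (1.7√τ/ω)·√(c0−τ)}, and ξ = √(1 + ((1−δ)/(π·ω·c0))·(ln ε2/ln ε1)) − 1; assume D < 1 and δ < 1. Set A = 4π²(1+ξ)²/(1−δ)², B = 4π(1+ξ)/(1−δ), code length m = A·c0²·⌈ln(1/ε1)⌉ (assumed an integer) and threshold Z = B·c0·⌈ln(1/ε1)⌉. Then the Tardos scheme with f = f^T, g1 = g1^T, g0 = g0^T is ε1-sound and (c0,ε2)-complete: for every coalition C of size at most c0, every admissible strategy, and every user j ∉ C, P[S_j > Z] < ε1; and for every coalition C of size at most c0 and every admissible strategy, P[S_j ≤ Z for all j ∈ C] < ε2. -/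

import Mathlib

open MeasureTheory ProbabilityTheory Real

noncomputable section

/-- Bernoulli measure on `Bool` with parameter `p`. -/
def bern (p : ℝ) : Measure Bool :=
  ENNReal.ofReal p • Measure.dirac true + ENNReal.ofReal (1 - p) • Measure.dirac false

/-- The measure on `ℝ` with density `f` (w.r.t. Lebesgue measure). -/
def biasMeasure (f : ℝ → ℝ) : Measure ℝ :=
  MeasureTheory.volume.withDensity fun p => ENNReal.ofReal (f p)

/-- Joint law of the biases `p = (p_1,…,p_m)` (i.i.d. with density `f`) together with the
code matrix `X` whose entries `X j i` are, conditionally on `p`, independent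
Bernoulli(`p i`). -/
def codeMeasure (n m : ℕ) (f : ℝ → ℝ) :
    Measure ((Fin m → ℝ) × (Fin n → Fin m → Bool)) :=
  (Measure.pi fun _ : Fin m => biasMeasure f).bind fun p =>
    (Measure.dirac p).prod (Measure.pi fun _ : Fin n => Measure.pi fun i : Fin m => bern (p i))

/-- The accusation sum `S_j = Σ_i y_i · (g1 (p_i) if X_{ji} = 1, g0 (p_i) if X_{ji} = 0)`. -/
def accusation (m : ℕ) (g1 g0 : ℝ → ℝ) (p : Fin m → ℝ) (x : Fin m → Bool)
    (y : Fin m → Bool) : ℝ :=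
  ∑ i, if y i then (if x i then g1 (p i) else g0 (p i)) else 0

def tprime (t : ℝ) : ℝ := Real.arcsin (Real.sqrt t)

/-- Tardos' bias density (extended by `0` outside `[t, 1-t]`). -/
def fT (t : ℝ) (p : ℝ) : ℝ :=
  if p ∈ Set.Icc t (1 - t) then 1 / ((π - 4 * tprime t) * Real.sqrt (p * (1 - p))) else 0

/-- Tardos' accusation function `g1`. -/
def g1T (p : ℝ) : ℝ := Real.sqrt ((1 - p) / p)

/-- Tardos' accusation function `g0`. -/
def g0T (p : ℝ) : ℝ := - Real.sqrt (p / (1 - p))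


lemma exp_17 : Real.exp 1.7 ≤ 5.48 := by
  have h1 := Real.exp_one_lt_d9
  have h2 : Real.exp 0.7 ≤ 2.01376 := by
    have := Real.exp_bound' (x := 0.7) (by norm_num) (by norm_num) (n := 8) (by norm_num)
    refine this.trans ?_
    norm_num [Finset.sum_range_succ, Nat.factorial]
  have : Real.exp 1.7 = Real.exp 1 * Real.exp 0.7 := by rw [← Real.exp_add]; norm_num
  rw [this]
  have h0 := Real.exp_pos 0.7
  nlinarith

lemma exp_le_quad (v : ℝ) (hv : v ≤ 1.7) : Real.exp v ≤ 1 + v + v ^ 2 := by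
  rcases le_total v (-1) with h | h
  · have : Real.exp v ≤ 1 := Real.exp_le_one_iff.2 (by linarith)
    nlinarith
  rcases le_total v 1 with h' | h'
  · have := Real.abs_exp_sub_one_sub_id_le (x := v) (abs_le.2 ⟨h, h'⟩)
    have := (abs_le.1 this).2
    linarith
  · have h1 := Real.exp_one_lt_d9
    have h2 := exp_17
    have hc := convexOn_exp.2 (Set.mem_univ (1:ℝ)) (Set.mem_univ (1.7:ℝ))
      (show (0:ℝ) ≤ (1.7 - v)/0.7 by apply div_nonneg <;> linarith)
      (show (0:ℝ) ≤ (v - 1)/0.7 by apply div_nonneg <;> linarith) (by ring)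
    simp only [smul_eq_mul] at hc
    have e : (1.7 - v)/0.7 * 1 + (v - 1)/0.7 * 1.7 = v := by ring
    rw [e] at hc
    refine hc.trans ?_
    have a1 : (1.7 - v)/0.7 * Real.exp 1 ≤ (1.7 - v)/0.7 * 2.719 := 
      mul_le_mul_of_nonneg_left (by linarith) (by apply div_nonneg <;> linarith)
    have a2 : (v-1)/0.7 * Real.exp 1.7 ≤ (v-1)/0.7 * 5.48 := 
      mul_le_mul_of_nonneg_left (by linarith) (by apply div_nonneg <;> linarith)
    refine (add_le_add a1 a2).trans ?_
    have e2 : (1.7 - v)/0.7 * 2.719 + (v-1)/0.7 * 5.48 = 2719/1000 + (v-1)*(2761/700) := by ring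
    rw [e2]
    nlinarith [sq_nonneg (v - 1472/1000)]

/-- positive part of the remainder -/
def Rm (v : ℝ) : ℝ := max 0 (Real.exp v - 1 - v - v ^ 2)

lemma Rm_nonneg (v : ℝ) : 0 ≤ Rm v := le_max_left _ _
lemma exp_le_Rm (v : ℝ) : Real.exp v ≤ 1 + v + v ^ 2 + Rm v := by
  have := le_max_right 0 (Real.exp v - 1 - v - v ^ 2)
  unfold Rm; linarith
lemma Rm_zero (v : ℝ) (hv : v ≤ 1.7) : Rm v = 0 := by
  have := exp_le_quad v hv
  exact max_eq_left (by linarith)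
lemma Rm_le (v : ℝ) (hv : 0 ≤ v) : Rm v ≤ Real.exp v := by
  refine max_le (Real.exp_pos _).le ?_
  nlinarith
lemma Rm_cont : Continuous Rm := by unfold Rm; fun_prop

lemma geom_shift (D : ℝ) (h0 : 0 < D) (h1 : D < 1) (l0 N : ℕ) :
    ∑ l ∈ Finset.range N, (if l0 ≤ l then D ^ (l - l0) else 0) ≤ 1 / (1 - D) := by
  have : ∑ l ∈ Finset.range N, (if l0 ≤ l then D ^ (l - l0) else 0) ≤ (1 - D ^ (N - l0)) / (1 - D) := by
    induction N with
    | zero => simp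
    | succ N ih =>
      rw [Finset.sum_range_succ]
      have hD : 1 - D ≠ 0 := by linarith
      by_cases h : l0 ≤ N
      · rw [if_pos h]
        refine (add_le_add_left ih _).trans ?_
        rw [Nat.succ_sub h, pow_succ]
        apply le_of_eq; field_simp; ring
      · rw [if_neg h]
        have e : N + 1 - l0 = N - l0 := by omega
        rw [e]; simpa using ih
  refine this.trans ?_
  have : 0 < 1 - D := by linarith
  gcongr
  have := pow_pos h0 (N - l0)
  linarith

lemma choose_le_exp (c l : ℕ) (hl : 1 ≤ l) :
    (c.choose l : ℝ) ≤ (Real.exp 1 * c / l) ^ l := by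
  have h1 : (c.choose l : ℝ) ≤ (c:ℝ) ^ l / (l.factorial : ℝ) := Nat.choose_le_pow_div l c
  have h2 := Real.pow_div_factorial_le_exp (l:ℝ) (by positivity) l
  have hf : (0:ℝ) < l.factorial := by positivity
  have hl' : (0:ℝ) < l := by exact_mod_cast hl
  have e : Real.exp (l:ℝ) = Real.exp 1 ^ l := by rw [← Real.exp_nat_mul]; simp
  rw [e, div_le_iff₀ hf] at h2
  refine h1.trans ?_
  rw [div_pow, mul_pow, div_le_div_iff₀ hf (by positivity)]
  have : (0:ℝ) ≤ (c:ℝ)^l := by positivity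
  nlinarith

set_option maxHeartbeats 2000000 in
/-- main per-term estimate -/
lemma term_bound (c0 c l : ℕ) (hc0 : 2 ≤ c0) (hc1 : 1 ≤ c) (hc : c ≤ c0) (hl1 : 1 ≤ l) (hl : l ≤ c)
    (τ ω t D q p : ℝ) (hτ0 : 0 < τ) (hτ1 : τ < 1/2) (hω0 : 0 < ω) (hω1 : ω < 1)
    (hωτ : ω ≤ 2 * Real.sqrt (τ * (c0:ℝ))) (ht : t = τ / c0)
    (hD : D = Real.exp 1 * (ω / 1.7) ^ 2) (hD1 : D < 1) (hq1 : t ≤ q) (hp1 : t ≤ p) (hpq : p + q = 1)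
    (v : ℝ) (hv : v = ω / c0 * ((l - c * q) / Real.sqrt (p * q))) (hv1 : 1.7 < v) :
    (c.choose l : ℝ) * q ^ l * p ^ (c - l) * Real.exp v ≤ 
      Real.exp 1.7 * D ^ ((l:ℝ) + (c0 - c) * t) ∧ 
    τ + (1.7 * Real.sqrt τ / ω) * Real.sqrt ((c0:ℝ) - τ) ≤ (l:ℝ) + (c0 - c) * t := by
  have hc0R : (2:ℝ) ≤ c0 := by exact_mod_cast hc0
  have hc1R : (1:ℝ) ≤ c := by exact_mod_cast hc1
  have hcR : (c:ℝ) ≤ c0 := by exact_mod_cast hc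
  have hl1R : (1:ℝ) ≤ l := by exact_mod_cast hl1
  have hlR : (l:ℝ) ≤ c := by exact_mod_cast hl
  have c0pos : (0:ℝ) < c0 := by linarith
  have tpos : 0 < t := by rw [ht]; positivity
  have htc : t * c0 = τ := by rw [ht]; field_simp
  have qpos : 0 < q := by linarith
  have ppos : 0 < p := by linarith
  have hDpos : 0 < D := by rw [hD]; positivity
  set σ := Real.sqrt (p * q) with hσ
  have σpos : 0 < σ := Real.sqrt_pos.2 (by positivity)
  have σsq : σ ^ 2 = p * q := Real.sq_sqrt (by positivity)
  have vpos : 0 < v := by linarith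
  -- s
  have hs : (l:ℝ) - c * q = v * c0 * σ / ω := by rw [hv]; field_simp
  have hs2 : (l:ℝ) - c * q ≤ l * p := by
    have : p = 1 - q := by linarith
    rw [this]; nlinarith
  have hσ' : v * c0 * σ ≤ ω * (l * p) := by
    rw [hs, div_le_iff₀ hω0] at hs2; linarith
  -- q ≤ (ω/v)^2 (l/c0)^2 p
  have hq : q * (v * c0)^2 ≤ ω^2 * l^2 * p := by
    have h1 : (v * c0 * σ)^2 ≤ (ω * (l * p))^2 := by gcongr
    have h2 : (v*c0*σ)^2 = (q * (v * c0)^2) * p := by rw [mul_pow, σsq]; ring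
    have h3 : (ω * (l * p))^2 = (ω^2 * l^2 * p) * p := by ring
    rw [h2, h3] at h1
    exact le_of_mul_le_mul_right h1 ppos
  -- lower bound on l
  have hlow : c * q + (1.7 * c0 / ω) * σ ≤ l := by
    have : (1.7 * c0 / ω) * σ ≤ v * c0 * σ / ω := by
      rw [div_mul_eq_mul_div]; gcongr
    linarith
  have hσt : Real.sqrt (t * (1 - t)) ≤ σ := by
    apply Real.sqrt_le_sqrt
    have : p = 1 - q := by linarith
    rw [this]; nlinarith
  have hsq : c0 * Real.sqrt (t * (1 - t)) = Real.sqrt τ * Real.sqrt ((c0:ℝ) - τ) := by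
    rw [← Real.sqrt_mul hτ0.le]
    have : τ * (c0 - τ) = c0 ^ 2 * (t * (1 - t)) := by rw [← htc]; ring
    rw [this, Real.sqrt_mul (sq_nonneg (c0:ℝ)), Real.sqrt_sq c0pos.le]
  have hk : (1.7 / ω) * (Real.sqrt τ * Real.sqrt ((c0:ℝ) - τ)) ≤ (1.7 * c0 / ω) * σ := by
    rw [← hsq]
    calc 1.7 / ω * (c0 * Real.sqrt (t * (1 - t))) ≤ 1.7 / ω * (c0 * σ) := by gcongr
      _ = _ := by ring
  have hτle : τ ≤ Real.sqrt τ * Real.sqrt ((c0:ℝ) - τ) := by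
    rw [← Real.sqrt_mul hτ0.le]
    apply Real.le_sqrt_of_sq_le
    nlinarith
  constructor
  · -- v ≤ 2 l
    have hv2 : v ≤ 2 * l := by
      have h1 : (v * c0)^2 * t ≤ ω^2 * l^2 := by
        have : p ≤ 1 := by linarith
        calc (v * c0)^2 * t ≤ (v*c0)^2 * q := by gcongr
          _ = q * (v * c0)^2 := by ring
          _ ≤ _ := hq
          _ ≤ ω^2 * l^2 * 1 := by gcongr
          _ = _ := by ring
      have h2 : ω ^ 2 ≤ 4 * (τ * c0) := by
        have := pow_le_pow_left₀ hω0.le hωτ 2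
        rw [mul_pow, Real.sq_sqrt (by positivity)] at this
        linarith
      have h3 : v ^ 2 * (c0 * τ) ≤ (2 * l)^2 * (c0 * τ) := by
        calc v ^ 2 * (c0 * τ) = (v * c0)^2 * t := by rw [← htc]; ring
          _ ≤ ω^2 * l^2 := h1
          _ ≤ (4 * (τ * c0)) * l^2 := by gcongr
          _ = _ := by ring
      have h4 := le_of_mul_le_mul_right h3 (by positivity)
      exact le_of_sq_le_sq h4 (by positivity)
    -- choose bound
    have hb : Real.exp 1 * c / l * q ≤ Real.exp 1 * (ω/v)^2 * (c/c0)^2 := by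
      have : q ≤ ω^2 * l^2 * p / (v * c0)^2 := by rw [le_div_iff₀ (by positivity)]; exact hq
      have hp : p ≤ 1 := by linarith
      calc Real.exp 1 * c / l * q ≤ Real.exp 1 * c / l * (ω^2 * l^2 * p / (v * c0)^2) := by gcongr
        _ ≤ Real.exp 1 * c / l * (ω^2 * l^2 * 1 / (v * c0)^2) := by gcongr
        _ = Real.exp 1 * (ω/v)^2 * (c * l / c0^2) := by field_simp
        _ ≤ Real.exp 1 * (ω/v)^2 * (c * c / c0^2) := by gcongr
        _ = _ := by ring
    have hT1 : (c.choose l : ℝ) * q ^ l * p ^ (c - l) ≤ (Real.exp 1 * (ω/v)^2 * (c/c0)^2)^l := by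
      have hp : p ^ (c-l) ≤ 1 := pow_le_one₀ ppos.le (by linarith)
      calc (c.choose l : ℝ) * q ^ l * p ^ (c - l) ≤ (Real.exp 1 * c / l) ^ l * q ^ l * 1 := by
            gcongr; exact choose_le_exp c l hl1
        _ = (Real.exp 1 * c / l * q)^l := by rw [mul_pow _ q]; ring
        _ ≤ _ := by gcongr
    -- v^{-2l} e^v ≤ 1.7^{-2l} e^{1.7}
    have hv3 : Real.exp v * (1.7 / v)^(2*l) ≤ Real.exp 1.7 := by
      have h1 : 1.7 / v ≤ Real.exp (-(v - 1.7)/v) := by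
        have := Real.add_one_le_exp (-(v-1.7)/v)
        refine le_trans (le_of_eq ?_) this
        field_simp; ring
      have h2 : (1.7/v)^(2*l) ≤ Real.exp (-(v-1.7)) := by
        calc (1.7/v)^(2*l) ≤ (Real.exp (-(v - 1.7)/v))^(2*l) := by gcongr
          _ = Real.exp ((2*l) * (-(v-1.7)/v)) := by rw [← Real.exp_nat_mul]; push_cast; rfl
          _ ≤ _ := by
            apply Real.exp_le_exp.2
            have : (2*l) * (-(v-1.7)/v) = -(v-1.7) * ((2*l)/v) := by ring
            rw [this]
            have : 1 ≤ (2*l)/v := by rw [le_div_iff₀ vpos]; linarith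
            nlinarith
      calc Real.exp v * (1.7 / v)^(2*l) ≤ Real.exp v * Real.exp (-(v-1.7)) := by gcongr
        _ = _ := by rw [← Real.exp_add]; congr 1; ring
    have hdec : ((c:ℝ)/c0)^(2*l) ≤ D ^ (((c0:ℝ) - c) * t) := by
      have h1 : (c:ℝ)/c0 ≤ Real.exp (-(c0 - c)/c0) := by
        have := Real.add_one_le_exp (-((c0:ℝ) - c)/c0)
        refine le_trans (le_of_eq ?_) this
        field_simp; ring
      have hlog : -(2 * (1.7 / ω)) ≤ Real.log D := by
        rw [hD, Real.log_mul (by positivity) (by positivity), Real.log_exp, Real.log_pow]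
        have : Real.log (ω/1.7) = - Real.log (1.7/ω) := by rw [← Real.log_inv]; congr 1; rw [inv_div]
        rw [this]
        have := Real.log_le_sub_one_of_pos (show 0 < 1.7/ω by positivity)
        push_cast; linarith
      rw [Real.rpow_def_of_pos hDpos]
      calc ((c:ℝ)/c0)^(2*l) ≤ (Real.exp (-(c0 - c)/c0))^(2*l) := by gcongr
        _ = Real.exp ((2*l) * (-(c0-c)/c0)) := by rw [← Real.exp_nat_mul]; push_cast; rfl
        _ ≤ _ := by
          apply Real.exp_le_exp.2
          have e1 : (2*l) * (-((c0:ℝ)-c)/c0) = -(((c0:ℝ)-c)/c0) * (2 * l) := by ring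
          have e2 : Real.log D * (((c0:ℝ)-c) * t) = -(((c0:ℝ)-c)/c0) * (- Real.log D * τ) := by
            rw [ht]; ring
          rw [e1, e2]
          have h0 : 0 ≤ ((c0:ℝ)-c)/c0 := div_nonneg (by linarith) c0pos.le
          have h3 : - Real.log D * τ ≤ 2 * l := by
            have : 1.7/ω * τ ≤ l := by
              have : 1.7/ω*τ ≤ (1.7 / ω) * (Real.sqrt τ * Real.sqrt ((c0:ℝ) - τ)) := by gcongr
              have : 0 ≤ c * q := by positivity
              linarith
            nlinarith
          nlinarith
    calc (c.choose l : ℝ) * q ^ l * p ^ (c - l) * Real.exp v 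
        ≤ (Real.exp 1 * (ω/v)^2 * (c/c0)^2)^l * Real.exp v := by gcongr
      _ = D ^ l * ((c:ℝ)/c0)^(2*l) * (Real.exp v * (1.7 / v)^(2*l)) := by
          have : ω / v = ω/1.7 * (1.7/v) := by field_simp
          rw [hD, this]; simp only [mul_pow, pow_mul]; ring
      _ ≤ D ^ l * D ^ (((c0:ℝ) - c) * t) * Real.exp 1.7 := by gcongr
      _ = _ := by rw [Real.rpow_add hDpos, Real.rpow_natCast]; ring
  · have e : τ = c0 * t := by linarith
    have : c * t ≤ c * q := by gcongr
    have h5 : (1.7 * Real.sqrt τ / ω) * Real.sqrt ((c0:ℝ) - τ) = (1.7 / ω) * (Real.sqrt τ * Real.sqrt ((c0:ℝ) - τ)) := by ring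
    rw [h5]
    nlinarith

lemma tail_bound (c0 c : ℕ) (hc0 : 2 ≤ c0) (hc1 : 1 ≤ c) (hc : c ≤ c0)
    (τ ω t D p : ℝ) (hτ0 : 0 < τ) (hτ1 : τ < 1/2) (hω0 : 0 < ω) (hω1 : ω < 1)
    (hωτ : ω ≤ 2 * Real.sqrt (τ * (c0:ℝ))) (ht : t = τ / c0)
    (hD : D = Real.exp 1 * (ω / 1.7) ^ 2) (hD1 : D < 1) (hp1 : t ≤ p) (hp2 : p ≤ 1 - t) :
    ∑ x ∈ Finset.range (c+1), (c.choose x : ℝ) * (p ^ x * (1-p) ^ (c - x) *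
       Rm (-(ω / c0 * ((x - c * p) / Real.sqrt (p * (1-p)))))) ≤
     Real.exp 1.7 / (1 - D) * D ^ (τ + (1.7 * Real.sqrt τ / ω) * Real.sqrt ((c0:ℝ) - τ)) := by
  have hDpos : 0 < D := by rw [hD]; positivity
  set E := τ + (1.7 * Real.sqrt τ / ω) * Real.sqrt ((c0:ℝ) - τ) with hE
  set a := ((c0:ℝ) - c) * t with ha
  have hc0pos : (0:ℝ) < c0 := by positivity
  have tpos : 0 < t := by rw [ht]; positivity
  have hpos : 0 < p * (1-p) := mul_pos (by linarith) (by linarith)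
  rw [← Finset.sum_range_reflect]
  have key : ∀ l ∈ Finset.range (c+1), 
      (c.choose (c + 1 - 1 - l) : ℝ) * (p ^ (c + 1 - 1 - l) * (1-p) ^ (c - (c + 1 - 1 - l)) *
       Rm (-(ω / c0 * (((c + 1 - 1 - l : ℕ) - c * p) / Real.sqrt (p * (1-p)))))) ≤ 
       Real.exp 1.7 * D ^ E * (if ⌈E - a⌉₊ ≤ l then D ^ (l - ⌈E - a⌉₊) else 0) := by
    intro l hl
    have hl : l ≤ c := by simpa [Nat.lt_succ_iff] using hl
    have e1 : c + 1 - 1 - l = c - l := by omega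
    have e2 : c - (c - l) = l := by omega
    rw [e1, e2, Nat.choose_symm hl]
    have e3 : -(ω / c0 * (((c - l : ℕ) - c * p) / Real.sqrt (p * (1-p)))) = 
        ω / c0 * ((l - c * (1-p)) / Real.sqrt (p * (1-p))) := by
      push_cast [hl]; ring
    rw [e3]
    set v := ω / c0 * ((l - c * (1-p)) / Real.sqrt (p * (1-p))) with hv
    have hR : 0 ≤ Real.exp 1.7 * D ^ E * (if ⌈E - a⌉₊ ≤ l then D ^ (l - ⌈E - a⌉₊) else 0) := by
      split_ifs <;> positivity
    by_cases h : v ≤ 1.7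
    · rw [Rm_zero v h]; simpa using hR
    push Not at h
    have hl1 : 1 ≤ l := by
      by_contra h0
      have : l = 0 := by omega
      have : v ≤ 0 := by
        rw [hv, this]
        apply mul_nonpos_of_nonneg_of_nonpos (by positivity)
        apply div_nonpos_of_nonpos_of_nonneg _ (Real.sqrt_nonneg _)
        push_cast
        have : (0:ℝ) ≤ c * (1-p) := mul_nonneg (by positivity) (by linarith)
        linarith
      linarith
    obtain ⟨h1, h2⟩ := term_bound c0 c l hc0 hc1 hc hl1 hl τ ω t D (1-p) p hτ0 hτ1 hω0 hω1 hωτ ht hD hD1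
      (by linarith) hp1 (by ring) v hv h
    have h3 : ⌈E - a⌉₊ ≤ l := Nat.ceil_le.2 (by linarith)
    rw [if_pos h3]
    calc (c.choose l : ℝ) * (p ^ (c - l) * (1-p) ^ l * Rm v) 
        ≤ (c.choose l : ℝ) * (p ^ (c - l) * (1-p) ^ l * Real.exp v) := by
          have : 0 ≤ 1 - p := by linarith
          have : 0 ≤ p := by linarith
          gcongr
          exact Rm_le v (by linarith)
      _ = (c.choose l : ℝ) * (1-p) ^ l * p ^ (c - l) * Real.exp v := by ring
      _ ≤ _ := h1
      _ ≤ Real.exp 1.7 * (D ^ E * D ^ ((l - ⌈E - a⌉₊ : ℕ) : ℝ)) := by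
          rw [← Real.rpow_add hDpos]
          gcongr Real.exp 1.7 * ?_
          apply Real.rpow_le_rpow_of_exponent_ge hDpos hD1.le
          push_cast [h3]
          have := Nat.le_ceil (E - a)
          linarith
      _ = _ := by rw [Real.rpow_natCast]; ring
  refine (Finset.sum_le_sum key).trans ?_
  rw [← Finset.mul_sum]
  calc _ ≤ Real.exp 1.7 * D ^ E * (1 / (1-D)) := by
        gcongr; exact geom_shift D hDpos hD1 _ _
    _ = _ := by ring

/-- normalising constant -/
def kap (t : ℝ) : ℝ := π - 4 * tprime t

lemma tprime_bd (t : ℝ) (h0 : 0 < t) (h1 : t < 1/2) : 0 < tprime t ∧ tprime t < π / 4 := by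
  constructor
  · exact Real.arcsin_pos.2 (Real.sqrt_pos.2 h0)
  · unfold tprime
    rw [Real.arcsin_lt_iff_lt_sin' ⟨by linarith [Real.pi_pos], by linarith [Real.pi_pos]⟩, Real.sin_pi_div_four]
    rw [Real.sqrt_lt' (by positivity)]
    rw [div_pow, Real.sq_sqrt (by norm_num)]; linarith

lemma kap_pos (t : ℝ) (h0 : 0 < t) (h1 : t < 1/2) : 0 < kap t := by
  have := tprime_bd t h0 h1; unfold kap; linarith
lemma kap_le (t : ℝ) (h0 : 0 < t) (h1 : t < 1/2) : kap t ≤ π := by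
  have := tprime_bd t h0 h1; unfold kap; linarith

def ker (t p : ℝ) : ℝ := 1 / (kap t * Real.sqrt (p * (1 - p)))
def J (t : ℝ) (g : ℝ → ℝ) : ℝ := ∫ p in t..(1-t), ker t p * g p
def U (c x : ℕ) (p : ℝ) : ℝ := (x - c * p) / Real.sqrt (p * (1 - p))
def wt (c x : ℕ) (p : ℝ) : ℝ := p ^ x * (1 - p) ^ (c - x)

lemma pq_pos {t p : ℝ} (h0 : 0 < t) (hp : p ∈ Set.Icc t (1-t)) : 0 < p * (1 - p) :=
  mul_pos (by linarith [hp.1]) (by linarith [hp.2])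

lemma ker_cont (t : ℝ) (h0 : 0 < t) (h1 : t < 1/2) : ContinuousOn (ker t) (Set.Icc t (1-t)) := by
  unfold ker
  apply ContinuousOn.div continuousOn_const (by fun_prop)
  intro p hp
  exact (mul_pos (kap_pos t h0 h1) (Real.sqrt_pos.2 (pq_pos h0 hp))).ne'

lemma ker_nonneg (t p : ℝ) (h0 : 0 < t) (h1 : t < 1/2) : 0 ≤ ker t p := by
  have := kap_pos t h0 h1
  unfold ker; positivity

lemma U_cont (c x : ℕ) (t : ℝ) (h0 : 0 < t) : ContinuousOn (U c x) (Set.Icc t (1-t)) := by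
  unfold U
  apply ContinuousOn.div (by fun_prop) (by fun_prop)
  intro p hp
  exact (Real.sqrt_pos.2 (pq_pos h0 hp)).ne'

lemma wt_cont (c x : ℕ) : Continuous (wt c x) := by unfold wt; fun_prop

lemma wt_nonneg (c x : ℕ) {t p : ℝ} (h0 : 0 < t) (hp : p ∈ Set.Icc t (1-t)) : 0 ≤ wt c x p := by
  have : 0 ≤ p := by linarith [hp.1]
  have : 0 ≤ 1 - p := by linarith [hp.2]
  unfold wt; positivity

lemma J_int (t : ℝ) (h0 : 0 < t) (h1 : t < 1/2) (g : ℝ → ℝ) (hg : ContinuousOn g (Set.Icc t (1-t))) :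
    IntervalIntegrable (fun p => ker t p * g p) volume t (1-t) := by
  apply ContinuousOn.intervalIntegrable
  rw [Set.uIcc_of_le (by linarith)]
  exact (ker_cont t h0 h1).mul hg

lemma J_add (t : ℝ) (h0 : 0 < t) (h1 : t < 1/2) (g h : ℝ → ℝ) (hg : ContinuousOn g (Set.Icc t (1-t)))
    (hh : ContinuousOn h (Set.Icc t (1-t))) : J t (fun p => g p + h p) = J t g + J t h := by
  unfold J
  rw [← intervalIntegral.integral_add (J_int t h0 h1 g hg) (J_int t h0 h1 h hh)]
  simp only [mul_add]

lemma J_smul (t a : ℝ) (g : ℝ → ℝ) : J t (fun p => a * g p) = a * J t g := by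
  unfold J
  rw [← intervalIntegral.integral_const_mul]
  congr 1; ext p; ring

lemma J_sum (t : ℝ) (h0 : 0 < t) (h1 : t < 1/2) {ι : Type*} (s : Finset ι) (g : ι → ℝ → ℝ)
    (hg : ∀ i ∈ s, ContinuousOn (g i) (Set.Icc t (1-t))) :
    J t (fun p => ∑ i ∈ s, g i p) = ∑ i ∈ s, J t (g i) := by
  unfold J
  rw [← intervalIntegral.integral_finsetSum (fun i hi => J_int t h0 h1 (g i) (hg i hi))]
  simp only [Finset.mul_sum]

lemma J_mono (t : ℝ) (h0 : 0 < t) (h1 : t < 1/2) (g h : ℝ → ℝ) (hg : ContinuousOn g (Set.Icc t (1-t)))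
    (hh : ContinuousOn h (Set.Icc t (1-t))) (hgh : ∀ p ∈ Set.Icc t (1-t), g p ≤ h p) : J t g ≤ J t h := by
  unfold J
  apply intervalIntegral.integral_mono_on (by linarith) (J_int t h0 h1 g hg) (J_int t h0 h1 h hh)
  intro p hp
  exact mul_le_mul_of_nonneg_left (hgh p hp) (ker_nonneg t p h0 h1)

lemma J_congr (t : ℝ) (h1 : t < 1/2) (g h : ℝ → ℝ) 
    (hgh : ∀ p ∈ Set.Icc t (1-t), g p = h p) : J t g = J t h := by
  unfold J
  apply intervalIntegral.integral_congr
  intro p hp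
  rw [Set.uIcc_of_le (by linarith)] at hp
  simp only [hgh p hp]

lemma J_nonneg (t : ℝ) (h0 : 0 < t) (h1 : t < 1/2) (g : ℝ → ℝ) 
    (hgh : ∀ p ∈ Set.Icc t (1-t), 0 ≤ g p) : 0 ≤ J t g := by
  unfold J
  apply intervalIntegral.integral_nonneg (by linarith)
  intro p hp
  exact mul_nonneg (ker_nonneg t p h0 h1) (hgh p hp)

lemma J_one (t : ℝ) (h0 : 0 < t) (h1 : t < 1/2) : J t (fun _ => 1) = 1 := by
  have hk := kap_pos t h0 h1
  have hd : ∀ p ∈ Set.uIcc t (1-t), HasDerivAt (fun p => Real.arcsin (2 * p - 1) / kap t) (ker t p * 1) p := by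
    intro p hp
    rw [Set.uIcc_of_le (by linarith)] at hp
    have hpq := pq_pos h0 hp
    have hd1 : HasDerivAt (fun p : ℝ => 2 * p - 1) 2 p := by
      simpa using ((hasDerivAt_id p).const_mul 2).sub_const 1
    have h2 := (Real.hasDerivAt_arcsin (x := 2 * p - 1) (by linarith [hp.1]) (by linarith [hp.2])).comp p hd1
    have h3 := h2.div_const (kap t)
    refine h3.congr_deriv ?_
    have e : 1 - (2 * p - 1)^2 = 2^2 * (p * (1-p)) := by ring
    rw [e, Real.sqrt_mul (by norm_num), Real.sqrt_sq (by norm_num)]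
    unfold ker
    have := Real.sqrt_pos.2 hpq
    field_simp
  unfold J
  rw [intervalIntegral.integral_eq_sub_of_hasDerivAt hd (J_int t h0 h1 (fun _ => 1) continuousOn_const)]
  have e : Real.arcsin (1 - 2 * t) = π/2 - 2 * tprime t := by
    have hb := tprime_bd t h0 h1
    apply Real.arcsin_eq_of_sin_eq
    · rw [Real.sin_pi_div_two_sub, Real.cos_two_mul, Real.cos_sq']
      unfold tprime
      rw [Real.sin_arcsin (by linarith [Real.sqrt_nonneg t]) (Real.sqrt_le_one.2 (by linarith)), Real.sq_sqrt h0.le]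
      ring
    · constructor <;> linarith [hb.1, hb.2, Real.pi_pos]
  have e1 : 2 * (1 - t) - 1 = 1 - 2 * t := by ring
  have e2 : 2 * t - 1 = -(1 - 2 * t) := by ring
  rw [e1, e2, Real.arcsin_neg, e]
  field_simp
  unfold kap; ring

lemma J_F (t : ℝ) (h0 : 0 < t) (h1 : t < 1/2) (c x : ℕ) (hx : x ≤ c) :
    J t (fun p => wt c x p * U c x p) = ((1-t)^x * t^(c-x) - t^x * (1-t)^(c-x)) / kap t := by
  have hk := kap_pos t h0 h1
  have hd : ∀ p ∈ Set.uIcc t (1-t), HasDerivAt (fun p => wt c x p / kap t) (ker t p * (wt c x p * U c x p)) p := by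
    intro p hp
    rw [Set.uIcc_of_le (by linarith)] at hp
    have hpq := pq_pos h0 hp
    have hd1 : HasDerivAt (fun p : ℝ => 1 - p) (-1) p := by
      simpa using (hasDerivAt_id p).const_sub 1
    have hd2 := ((hasDerivAt_pow x p).mul (hd1.pow (c-x))).div_const (kap t)
    refine HasDerivAt.congr_deriv (f := fun p => wt c x p / kap t) hd2 ?_
    unfold ker U wt
    have hs := Real.sqrt_pos.2 hpq
    have hs2 : Real.sqrt (p * (1-p)) * Real.sqrt (p * (1-p)) = p * (1-p) := Real.mul_self_sqrt hpq.le
    have e : 1 / (kap t * Real.sqrt (p * (1-p))) * (p^x * (1-p)^(c-x) * ((x - c * p)/Real.sqrt (p * (1-p)))) = 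
       p^x * (1-p)^(c-x) * (x - c * p) / (p * (1-p)) / kap t := by
      generalize Real.sqrt (p * (1-p)) = s at hs hs2
      rw [← hs2]; field_simp
    rw [e]
    congr 1
    have hp0 : p ≠ 0 := by linarith [hp.1]
    have hq0 : 1 - p ≠ 0 := by linarith [hp.2]
    rw [eq_div_iff hpq.ne']
    obtain ⟨y, rfl⟩ : ∃ y, c = x + y := ⟨c - x, by omega⟩
    simp only [Nat.add_sub_cancel_left]
    rcases x with _ | x <;> rcases y with _ | y <;> simp [pow_succ] <;> ring
  unfold J
  rw [intervalIntegral.integral_eq_sub_of_hasDerivAt hd 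
    (J_int t h0 h1 _ ((wt_cont c x).continuousOn.mul (U_cont c x t h0)))]
  unfold wt
  have : 1 - (1 - t) = t := by ring
  rw [this, sub_div]

lemma lint_bias (t : ℝ) (h0 : 0 < t) (h1 : t < 1/2) (g : ℝ → ℝ) (hm : Measurable g)
    (hg : ContinuousOn g (Set.Icc t (1-t)))
    (hn : ∀ p ∈ Set.Icc t (1-t), 0 ≤ g p) :
    ∫⁻ p, ENNReal.ofReal (g p) ∂(biasMeasure (fT t)) = ENNReal.ofReal (J t g) := by
  have hf : Measurable (fT t) := by
    unfold fT
    exact Measurable.ite measurableSet_Icc (by fun_prop) measurable_const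
  unfold biasMeasure
  rw [lintegral_withDensity_eq_lintegral_mul _ (by fun_prop) (by fun_prop)]
  have : ∀ p, ((fun p => ENNReal.ofReal (fT t p)) * fun p => ENNReal.ofReal (g p)) p = 
      (Set.Icc t (1-t)).indicator (fun p => ENNReal.ofReal (ker t p * g p)) p := by
    intro p
    simp only [Pi.mul_apply, Set.indicator_apply]
    unfold fT
    split_ifs with h
    · rw [ENNReal.ofReal_mul (ker_nonneg t p h0 h1)]; rfl
    · simp
  rw [lintegral_congr this, lintegral_indicator measurableSet_Icc]
  unfold J
  rw [intervalIntegral.integral_of_le (by linarith), ← integral_Icc_eq_integral_Ioc]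
  rw [ofReal_integral_eq_lintegral_ofReal]
  · exact ((ker_cont t h0 h1).mul hg).integrableOn_Icc
  · filter_upwards [ae_restrict_mem measurableSet_Icc] with p hp
    exact mul_nonneg (ker_nonneg t p h0 h1) (hn p hp)

lemma sum_wt (c : ℕ) (p : ℝ) : ∑ x ∈ Finset.range (c+1), (c.choose x : ℝ) * wt c x p = 1 := by
  have := add_pow p (1-p) c
  simp only [add_sub_cancel, one_pow] at this
  rw [this]
  apply Finset.sum_congr rfl
  intro x _; unfold wt; ring

lemma sum_wt_var (c : ℕ) {p : ℝ} (hp : 0 < p * (1 - p)) : 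
    ∑ x ∈ Finset.range (c+1), (c.choose x : ℝ) * (wt c x p * U c x p ^ 2) = c := by
  have := congrArg (Polynomial.eval p) (bernsteinPolynomial.variance ℝ c)
  simp only [Polynomial.eval_finsetSum, bernsteinPolynomial] at this
  simp at this
  have h2 : ∀ x ∈ Finset.range (c+1), (c.choose x : ℝ) * (wt c x p * U c x p ^ 2) = 
     ((c * p - x)^2 * (c.choose x * p^x * (1-p)^(c-x))) / (p * (1-p)) := by
    intro x _
    unfold wt U
    rw [div_pow, Real.sq_sqrt hp.le]; ring
  rw [Finset.sum_congr rfl h2, ← Finset.sum_div, this]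
  rw [div_eq_iff hp.ne']; ring

def Nx (t : ℝ) (c x : ℕ) : ℝ :=
  ((if x = 0 then 0 else t ^ x * (1-t) ^ (c-x)) - (if x = c then (1-t)^c else 0)) / kap t

def Kx (t β : ℝ) (c x : ℕ) : ℝ :=
  J t (wt c x) + β * Nx t c x + β ^ 2 * J t (fun p => wt c x p * U c x p ^ 2) + 
    J t (fun p => wt c x p * Rm (-(β * U c x p)))

lemma wR_cont (t β : ℝ) (c x : ℕ) (h0 : 0 < t) : 
    ContinuousOn (fun p => wt c x p * Rm (-(β * U c x p))) (Set.Icc t (1-t)) :=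
  (wt_cont c x).continuousOn.mul 
    (Rm_cont.comp_continuousOn (continuousOn_const.mul (U_cont c x t h0)).neg)

lemma wU2_cont (t : ℝ) (c x : ℕ) (h0 : 0 < t) : 
    ContinuousOn (fun p => wt c x p * U c x p ^ 2) (Set.Icc t (1-t)) :=
  (wt_cont c x).continuousOn.mul ((U_cont c x t h0).pow 2)

lemma Kx_y0 (t β : ℝ) (h0 : 0 < t) (h1 : t < 1/2) (hβ : 0 ≤ β) (c x : ℕ) (hx : x < c) : 
    J t (wt c x) ≤ Kx t β c x := by
  unfold Kx
  have a1 : 0 ≤ Nx t c x := by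
    have := kap_pos t h0 h1
    have : 0 ≤ 1 - t := by linarith
    unfold Nx
    rw [if_neg hx.ne]
    split_ifs <;> simp <;> positivity
  have a2 : 0 ≤ J t (fun p => wt c x p * U c x p ^ 2) := J_nonneg t h0 h1 _ 
    fun p hp => mul_nonneg (wt_nonneg c x h0 hp) (sq_nonneg _)
  have a3 : 0 ≤ J t (fun p => wt c x p * Rm (-(β * U c x p))) := J_nonneg t h0 h1 _ 
    fun p hp => mul_nonneg (wt_nonneg c x h0 hp) (Rm_nonneg _)
  have := mul_nonneg hβ a1
  have := mul_nonneg (sq_nonneg β) a2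
  linarith

lemma wexp_cont (t β : ℝ) (c x : ℕ) (h0 : 0 < t) : 
    ContinuousOn (fun p => wt c x p * Real.exp (-(β * U c x p))) (Set.Icc t (1-t)) :=
  (wt_cont c x).continuousOn.mul 
    (Real.continuous_exp.comp_continuousOn (continuousOn_const.mul (U_cont c x t h0)).neg)

lemma Kx_y1 (t β : ℝ) (h0 : 0 < t) (h1 : t < 1/2) (hβ : 0 ≤ β) (c x : ℕ) (hx0 : 0 < x) (hx : x ≤ c) : 
    J t (fun p => wt c x p * Real.exp (-(β * U c x p))) ≤ Kx t β c x := by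
  have hk := kap_pos t h0 h1
  have cw := (wt_cont c x).continuousOn (s := Set.Icc t (1-t))
  have cU : ContinuousOn (fun p => -β * (wt c x p * U c x p)) (Set.Icc t (1-t)) :=
    continuousOn_const.mul (cw.mul (U_cont c x t h0))
  have cU2 : ContinuousOn (fun p => β^2 * (wt c x p * U c x p ^ 2)) (Set.Icc t (1-t)) :=
    continuousOn_const.mul (wU2_cont t c x h0)
  have cA : ContinuousOn (fun p => wt c x p + -β * (wt c x p * U c x p)) (Set.Icc t (1-t)) := cw.add cU
  have cB : ContinuousOn (fun p => wt c x p + -β * (wt c x p * U c x p) + β^2 * (wt c x p * U c x p ^ 2)) (Set.Icc t (1-t)) := cA.add cU2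
  have cR := wR_cont t β c x h0
  have step : J t (fun p => wt c x p * Real.exp (-(β * U c x p))) ≤ 
     J t (fun p => ((wt c x p + (-β) * (wt c x p * U c x p)) + β^2 * (wt c x p * U c x p ^ 2)) + wt c x p * Rm (-(β * U c x p))) := by
    apply J_mono t h0 h1 _ _ (wexp_cont t β c x h0)
    · exact cB.add cR
    · intro p hp
      have := mul_le_mul_of_nonneg_left (exp_le_Rm (-(β * U c x p))) (wt_nonneg c x h0 hp)
      refine this.trans (le_of_eq ?_)
      ring
  refine step.trans ?_
  rw [J_add t h0 h1 _ _ cB cR, J_add t h0 h1 _ _ cA cU2, J_add t h0 h1 _ _ cw cU, J_smul t (-β) (fun p => wt c x p * U c x p), 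
    J_smul t (β^2) (fun p => wt c x p * U c x p ^ 2), J_F t h0 h1 c x hx]
  unfold Kx
  have : -(((1-t)^x * t^(c-x) - t^x * (1-t)^(c-x)) / kap t) ≤ Nx t c x := by
    unfold Nx
    rw [← neg_div, if_neg hx0.ne']
    gcongr
    split_ifs with h
    · subst h; simp
    · have : 0 ≤ 1 - t := by linarith
      have : 0 ≤ (1-t)^x * t^(c-x) := by positivity
      linarith
  have := mul_le_mul_of_nonneg_left this hβ
  linarith

lemma sum_Nx (t : ℝ) (h0 : 0 < t) (h1 : t < 1/2) (c : ℕ) :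
    ∑ x ∈ Finset.range (c+1), (c.choose x : ℝ) * Nx t c x ≤ (2 * (c * t) - 1) / kap t := by
  have hk := kap_pos t h0 h1
  have e : ∀ x ∈ Finset.range (c+1), (c.choose x : ℝ) * Nx t c x = 
     ((c.choose x : ℝ) * wt c x t - (if x = 0 then (1-t)^c else 0) - (if x = c then (1-t)^c else 0)) / kap t := by
    intro x _
    unfold Nx wt
    split_ifs with h h' h' <;> (try subst h) <;> (try subst h') <;> simp <;> ring
  rw [Finset.sum_congr rfl e, ← Finset.sum_div, Finset.sum_sub_distrib, Finset.sum_sub_distrib, sum_wt]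
  simp only [Finset.sum_ite_eq', Finset.mem_range]
  rw [if_pos (by omega), if_pos (by omega)]
  apply div_le_div_of_nonneg_right _ hk.le
  have := one_add_mul_le_pow (a := -t) (by linarith) c
  have e : 1 + -t = 1 - t := by ring
  rw [e] at this
  linarith

lemma Kx_sum (c0 c : ℕ) (hc0 : 2 ≤ c0) (hc1 : 1 ≤ c) (hc : c ≤ c0)
    (τ ω t D δ : ℝ) (hτ0 : 0 < τ) (hτ1 : τ < 1/2) (hω0 : 0 < ω) (hω1 : ω < 1)
    (hωτ : ω ≤ 2 * Real.sqrt (τ * (c0:ℝ))) (ht : t = τ / c0)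
    (hD : D = Real.exp 1 * (ω / 1.7) ^ 2) (hD1 : D < 1) 
    (hδ : δ = 2 * τ + π * ω + Real.exp 1.7 * (π * (c0:ℝ) / (ω * (1 - D))) *
        D ^ (τ + (1.7 * Real.sqrt τ / ω) * Real.sqrt ((c0:ℝ) - τ))) :
    ∑ x ∈ Finset.range (c+1), (c.choose x : ℝ) * Kx t (ω/c0) c x ≤ 1 - ω/c0 * (1-δ) / π := by
  have hc0R : (2:ℝ) ≤ c0 := by exact_mod_cast hc0
  have hcR : (c:ℝ) ≤ c0 := by exact_mod_cast hc
  have h0 : 0 < t := by rw [ht]; positivity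
  have h1 : t < 1/2 := by
    rw [ht, div_lt_iff₀ (by positivity)]; nlinarith
  have hk := kap_pos t h0 h1
  set β := ω / c0 with hβ
  have βpos : 0 < β := by positivity
  have e : ∑ x ∈ Finset.range (c+1), (c.choose x : ℝ) * Kx t β c x = 
      1 + β * ∑ x ∈ Finset.range (c+1), (c.choose x : ℝ) * Nx t c x + β ^ 2 * c + 
      J t (fun p => ∑ x ∈ Finset.range (c+1), (c.choose x : ℝ) * (wt c x p * Rm (-(β * U c x p)))) := by
    have e1 : ∑ x ∈ Finset.range (c+1), (c.choose x : ℝ) * J t (wt c x) = 1 := by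
      simp only [← J_smul]
      rw [← J_sum t h0 h1 _ (fun x p => (c.choose x : ℝ) * wt c x p) (fun i _ => (continuous_const.mul (wt_cont c i)).continuousOn)]
      simp only [sum_wt]
      exact J_one t h0 h1
    have e2 : ∑ x ∈ Finset.range (c+1), (c.choose x : ℝ) * J t (fun p => wt c x p * U c x p ^ 2) = c := by
      simp only [← J_smul]
      rw [← J_sum t h0 h1 _ (fun x p => (c.choose x : ℝ) * (wt c x p * U c x p ^ 2)) (fun i _ => (continuousOn_const.mul (wU2_cont t c i h0)))]
      rw [J_congr t h1 _ (fun _ => (c:ℝ) * 1) (fun p hp => by rw [sum_wt_var c (pq_pos h0 hp), mul_one])]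
      rw [J_smul t c (fun _ => 1), J_one t h0 h1, mul_one]
    have e3 : ∑ x ∈ Finset.range (c+1), (c.choose x : ℝ) * J t (fun p => wt c x p * Rm (-(β * U c x p))) = 
       J t (fun p => ∑ x ∈ Finset.range (c+1), (c.choose x : ℝ) * (wt c x p * Rm (-(β * U c x p)))) := by
      simp only [← J_smul]
      rw [← J_sum t h0 h1 _ (fun x p => (c.choose x : ℝ) * (wt c x p * Rm (-(β * U c x p)))) (fun i _ => (continuousOn_const.mul (wR_cont t β c i h0)))]
    rw [← e3]
    have e4 : ∑ x ∈ Finset.range (c+1), (c.choose x : ℝ) * Kx t β c x =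
        ∑ x ∈ Finset.range (c+1), (c.choose x : ℝ) * J t (wt c x)
        + β * ∑ x ∈ Finset.range (c+1), (c.choose x : ℝ) * Nx t c x
        + β ^ 2 * ∑ x ∈ Finset.range (c+1), (c.choose x : ℝ) * J t (fun p => wt c x p * U c x p ^ 2)
        + ∑ x ∈ Finset.range (c+1), (c.choose x : ℝ) * J t (fun p => wt c x p * Rm (-(β * U c x p))) := by
      unfold Kx
      rw [Finset.mul_sum, Finset.mul_sum, ← Finset.sum_add_distrib, ← Finset.sum_add_distrib, ← Finset.sum_add_distrib]
      apply Finset.sum_congr rfl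
      intro x _; ring
    rw [e4, e1, e2]
  rw [e]
  have hN : ∑ x ∈ Finset.range (c+1), (c.choose x : ℝ) * Nx t c x ≤ (2 * τ - 1) / π := by
    refine (sum_Nx t h0 h1 c).trans ?_
    have : c * t ≤ τ := by
      rw [ht, mul_div_assoc', div_le_iff₀ (by positivity)]; nlinarith
    calc (2 * (c * t) - 1) / kap t ≤ (2 * τ - 1) / kap t := by gcongr
      _ ≤ _ := by
        rw [div_le_div_iff₀ hk Real.pi_pos]
        nlinarith [kap_le t h0 h1]
  have hT : J t (fun p => ∑ x ∈ Finset.range (c+1), (c.choose x : ℝ) * (wt c x p * Rm (-(β * U c x p)))) ≤ 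
     Real.exp 1.7 / (1 - D) * D ^ (τ + (1.7 * Real.sqrt τ / ω) * Real.sqrt ((c0:ℝ) - τ)) := by
    have : J t (fun p => ∑ x ∈ Finset.range (c+1), (c.choose x : ℝ) * (wt c x p * Rm (-(β * U c x p)))) ≤ 
      J t (fun _ => (Real.exp 1.7 / (1 - D) * D ^ (τ + (1.7 * Real.sqrt τ / ω) * Real.sqrt ((c0:ℝ) - τ))) * 1) := by
      apply J_mono t h0 h1
      · exact continuousOn_finsetSum _ (fun i _ => (continuousOn_const.mul (wR_cont t β c i h0)))
      · exact continuousOn_const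
      · intro p hp
        rw [mul_one]
        exact tail_bound c0 c hc0 hc1 hc τ ω t D p hτ0 hτ1 hω0 hω1 hωτ ht hD hD1 hp.1 hp.2
    rwa [J_smul t _ (fun _ => 1), J_one t h0 h1, mul_one] at this
  have hb2 : β^2 * c ≤ β * ω := by
    have : β * c ≤ ω := by rw [hβ, div_mul_eq_mul_div, div_le_iff₀ (by positivity)]; gcongr
    nlinarith
  have := mul_le_mul_of_nonneg_left hN βpos.le
  have fin : 1 + β * ((2 * τ - 1)/π) + β * ω + Real.exp 1.7 / (1 - D) * D ^ (τ + (1.7 * Real.sqrt τ / ω) * Real.sqrt ((c0:ℝ) - τ)) = 1 - β * (1-δ)/π := by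
    rw [hδ]
    generalize D ^ (τ + (1.7 * Real.sqrt τ / ω) * Real.sqrt ((c0:ℝ) - τ)) = Q
    have h1D : 1 - D ≠ 0 := by linarith
    have := Real.pi_pos
    rw [hβ]
    field_simp
    ring
  linarith

def wb (p : ℝ) (b : Bool) : ℝ := if b then p else 1 - p

lemma wb_nonneg {t p : ℝ} (h0 : 0 < t) (hp : p ∈ Set.Icc t (1-t)) (b : Bool) : 0 ≤ wb p b := by
  unfold wb; split_ifs <;> linarith [hp.1, hp.2]

lemma wb_meas (b : Bool) : Measurable (fun p => wb p b) := by
  unfold wb; split_ifs <;> fun_prop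

instance bern_fin (p : ℝ) : IsFiniteMeasure (bern p) := by
  unfold bern
  constructor
  simp

lemma bern_singleton (p : ℝ) (b : Bool) : bern p {b} = ENNReal.ofReal (wb p b) := by
  unfold bern wb
  cases b <;> simp

def Wt (n m : ℕ) (p : Fin m → ℝ) (X : Fin n → Fin m → Bool) : ENNReal :=
  ∏ j, ∏ i, ENNReal.ofReal (wb (p i) (X j i))

lemma Wt_meas (n m : ℕ) (X : Fin n → Fin m → Bool) : Measurable (fun p => Wt n m p X) := by
  unfold Wt
  refine Finset.measurable_fun_prod _ fun j _ => Finset.measurable_fun_prod _ fun i _ => ?_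
  exact ENNReal.measurable_ofReal.comp ((wb_meas _).comp (measurable_pi_apply i))

instance bias_sf (f : ℝ → ℝ) : SigmaFinite (biasMeasure f) := by
  unfold biasMeasure; infer_instance

lemma master (n m : ℕ) (f : ℝ → ℝ) (Ω' : Type) [MeasurableSpace Ω'] (μ' : Measure Ω') [IsProbabilityMeasure μ']
    (F : ((Fin m → ℝ) × (Fin n → Fin m → Bool)) × Ω' → ENNReal) (hF : Measurable F) (Bd : ENNReal)
    (h : ∀ r, ∫⁻ p, ∑ X, Wt n m p X * F ((p, X), r) ∂(Measure.pi fun _ : Fin m => biasMeasure f) ≤ Bd) :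
    ∫⁻ q, F q ∂((codeMeasure n m f).prod μ') ≤ Bd := by
  refine (lintegral_prod_le _).trans ?_
  unfold codeMeasure
  refine (Measure.lintegral_bind_le _ _ _).trans ?_
  have key : ∀ p : Fin m → ℝ, ∫⁻ x, ∫⁻ r, F (x, r) ∂μ' ∂((Measure.dirac p).prod 
      (Measure.pi fun _ : Fin n => Measure.pi fun i : Fin m => bern (p i))) ≤ 
      ∫⁻ r, ∑ X, Wt n m p X * F ((p, X), r) ∂μ' := by
    intro p
    refine (lintegral_prod_le _).trans ?_
    rw [lintegral_dirac, lintegral_fintype]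
    have hFX : ∀ X, Measurable (fun r => F ((p, X), r)) := fun X =>
      hF.comp (measurable_const.prodMk measurable_id)
    rw [lintegral_finsetSum _ (fun X _ => (hFX X).const_mul _)]
    apply Finset.sum_le_sum
    intro X _
    rw [Measure.pi_singleton, mul_comm]
    simp only [Measure.pi_singleton, bern_singleton]
    rw [lintegral_const_mul _ (hFX X)]
    rfl
  refine (lintegral_mono key).trans ?_
  rw [lintegral_lintegral_swap]
  · refine (lintegral_mono h).trans ?_
    simp
  · refine Measurable.aemeasurable ?_
    refine Finset.measurable_fun_sum _ fun X _ => ?_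
    exact ((Wt_meas n m X).comp measurable_fst).mul 
      (hF.comp ((measurable_fst.prodMk measurable_const).prodMk measurable_snd))

lemma bias_prob (t : ℝ) (h0 : 0 < t) (h1 : t < 1/2) : IsProbabilityMeasure (biasMeasure (fT t)) := by
  constructor
  have := lint_bias t h0 h1 (fun _ => 1) measurable_const continuousOn_const (fun _ _ => zero_le_one)
  rw [J_one t h0 h1] at this
  simpa using this

lemma bias_ae (t : ℝ) : ∀ᵐ p ∂(biasMeasure (fT t)), p ∈ Set.Icc t (1-t) := by
  have hf : Measurable (fT t) := by
    unfold fT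
    exact Measurable.ite measurableSet_Icc (by fun_prop) measurable_const
  unfold biasMeasure
  rw [ae_withDensity_iff (by fun_prop)]
  filter_upwards with p hp
  by_contra h
  apply hp
  unfold fT
  rw [if_neg h]; simp

lemma pi_ae (t : ℝ) (m : ℕ) : ∀ᵐ p ∂(Measure.pi fun _ : Fin m => biasMeasure (fT t)), ∀ i, p i ∈ Set.Icc t (1-t) := by
  rw [ae_all_iff]
  intro i
  exact Measure.tendsto_eval_ae_ae.eventually (bias_ae t)

lemma pi_prod_lint (t : ℝ) (h0 : 0 < t) (h1 : t < 1/2) (m : ℕ) (g : Fin m → ℝ → ENNReal) (hg : ∀ i, Measurable (g i)) :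
    ∫⁻ p, ∏ i, g i (p i) ∂(Measure.pi fun _ : Fin m => biasMeasure (fT t)) = ∏ i, ∫⁻ x, g i x ∂(biasMeasure (fT t)) := by
  have := bias_prob t h0 h1
  have hi := iIndepFun_pi (μ := fun _ : Fin m => biasMeasure (fT t)) (X := g) (fun i => (hg i).aemeasurable)
  rw [lintegral_prod_eq_prod_lintegral_of_indepFun Finset.univ (fun i (p : Fin m → ℝ) => g i (p i)) hi 
    (fun i => (hg i).comp (measurable_pi_apply i))]
  apply Finset.prod_congr rfl
  intro i _
  exact (measurePreserving_eval (fun _ : Fin m => biasMeasure (fT t)) i).lintegral_comp (hg i)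

lemma sum_prod_pi {ι κ R : Type*} [Fintype ι] [DecidableEq ι] [Fintype κ] [CommSemiring R] (g : ι → κ → R) :
    ∑ x : ι → κ, ∏ i, g i (x i) = ∏ i, ∑ b, g i b := by
  rw [Finset.prod_univ_sum, Fintype.piFinset_univ]

lemma sum_W_one {κ : Type*} [Fintype κ] [DecidableEq κ] (m : ℕ) (p : Fin m → ℝ) :
    ∑ X : κ → Fin m → Bool, ∏ k, ∏ i, wb (p i) (X k i) = 1 := by
  rw [sum_prod_pi (fun (_ : κ) (x : Fin m → Bool) => ∏ i, wb (p i) (x i))]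
  rw [sum_prod_pi]
  simp [wb]

def uT (p : ℝ) (b : Bool) : ℝ := if b then g1T p else g0T p

lemma uT_eq {p : ℝ} (hp0 : 0 < p) (hp1 : p < 1) (b : Bool) : 
    uT p b = ((if b then 1 else 0) - p) / Real.sqrt (p * (1-p)) := by
  have h1 : 0 < 1 - p := by linarith
  have s1 := Real.sqrt_pos.2 hp0
  have s2 := Real.sqrt_pos.2 h1
  have e1 := Real.sq_sqrt hp0.le
  have e2 := Real.sq_sqrt h1.le
  unfold uT g1T g0T
  rw [Real.sqrt_div h1.le, Real.sqrt_div hp0.le, Real.sqrt_mul hp0.le]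
  cases b
  · simp only [Bool.false_eq_true, if_false]
    field_simp
    rw [e1]; ring
  · simp only [if_true]
    field_simp
    rw [e2]

lemma acc_eq (m : ℕ) (p : Fin m → ℝ) (x y : Fin m → Bool) :
    accusation m g1T g0T p x y = ∑ i, if y i then uT (p i) (x i) else 0 := rfl

lemma sound_single {t α p : ℝ} (h0 : 0 < t) (h1 : t < 1/2) (hα : 0 ≤ α) (hαt : α ≤ 1.7 * Real.sqrt t)
    (hp : p ∈ Set.Icc t (1-t)) (y : Bool) :
    ∑ b, wb p b * Real.exp (α * if y then uT p b else 0) ≤ 1 + α ^ 2 := by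
  cases y
  · simp [wb]; positivity
  have hp0 : 0 < p := by linarith [hp.1]
  have hp1 : 0 < 1 - p := by linarith [hp.2]
  have hpq := pq_pos h0 hp
  have hs := Real.sqrt_pos.2 hpq
  have hss := Real.sq_sqrt hpq.le
  simp only [if_true, Fintype.sum_bool, wb]
  have b1 : Real.exp (α * uT p true) ≤ 1 + α * uT p true + (α * uT p true)^2 := by
    apply exp_le_quad
    have : uT p true ≤ 1 / Real.sqrt t := by
      simp only [uT, if_true, g1T]
      rw [show (1:ℝ) / Real.sqrt t = Real.sqrt (1 / t) by rw [Real.sqrt_div zero_le_one, Real.sqrt_one]]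
      apply Real.sqrt_le_sqrt
      apply div_le_div₀ zero_le_one (by linarith) h0 hp.1
    calc α * uT p true ≤ α * (1 / Real.sqrt t) := by gcongr
      _ ≤ 1.7 := by
        have := Real.sqrt_pos.2 h0
        rw [mul_one_div, div_le_iff₀ this]; exact hαt
  have b2 : Real.exp (α * uT p false) ≤ 1 + α * uT p false + (α * uT p false)^2 := by
    apply exp_le_quad
    have : uT p false ≤ 0 := by
      simp only [uT, g0T]
      simp
    have := mul_nonneg_of_nonpos_of_nonpos this (neg_nonpos.2 hα)
    linarith
  rw [uT_eq hp0 (by linarith)] at b1 b2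
  rw [uT_eq hp0 (by linarith), uT_eq hp0 (by linarith)]
  simp only [if_true, Bool.false_eq_true, if_false] at b1 b2 ⊢
  refine (add_le_add (mul_le_mul_of_nonneg_left b1 hp0.le) (mul_le_mul_of_nonneg_left b2 hp1.le)).trans ?_
  apply le_of_eq
  generalize Real.sqrt (p * (1-p)) = s at hs hss
  have : 1 + α^2 = 1 + α^2 * (p * (1-p) / s^2) := by rw [hss]; field_simp
  rw [this]
  field_simp
  ring

lemma sound_real (n m : ℕ) {t α : ℝ} (h0 : 0 < t) (h1 : t < 1/2) (hα : 0 ≤ α) (hαt : α ≤ 1.7 * Real.sqrt t)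
    (p : Fin m → ℝ) (hp : ∀ i, p i ∈ Set.Icc t (1-t)) (j : Fin n) (y : (Fin n → Fin m → Bool) → Fin m → Bool)
    (hy : ∀ X X', (∀ k, k ≠ j → X k = X' k) → y X = y X') :
    ∑ X, (∏ k, ∏ i, wb (p i) (X k i)) * Real.exp (α * accusation m g1T g0T p (X j) (y X)) ≤ (1 + α^2)^m := by
  set e := (Equiv.funSplitAt j (Fin m → Bool)) with he
  have hj : ∀ z, (e.symm z) j = z.1 := by intro z; simp [he]
  have hk : ∀ z (k : {k // k ≠ j}), (e.symm z) k = z.2 k := by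
    intro z k; simp [he, k.2]
  rw [← Equiv.sum_comp e.symm, Fintype.sum_prod_type_right]
  set Y : ({k // k ≠ j} → Fin m → Bool) → Fin m → Bool := fun X' => y (e.symm (fun _ => false, X')) with hY
  have hYy : ∀ x X', y (e.symm (x, X')) = Y X' := by
    intro x X'
    apply hy
    intro k hkj
    rw [hk _ ⟨k, hkj⟩, hk _ ⟨k, hkj⟩]
  have inner : ∀ X' : {k // k ≠ j} → Fin m → Bool, 
     ∑ x : Fin m → Bool, (∏ k, ∏ i, wb (p i) ((e.symm (x, X')) k i)) * 
       Real.exp (α * accusation m g1T g0T p ((e.symm (x, X')) j) (y (e.symm (x, X')))) ≤ 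
       (∏ k, ∏ i, wb (p i) (X' k i)) * (1 + α^2)^m := by
    intro X'
    have : ∀ x : Fin m → Bool, (∏ k, ∏ i, wb (p i) ((e.symm (x, X')) k i)) * 
       Real.exp (α * accusation m g1T g0T p ((e.symm (x, X')) j) (y (e.symm (x, X')))) = 
       (∏ k, ∏ i, wb (p i) (X' k i)) * ∏ i, (wb (p i) (x i) * Real.exp (α * if Y X' i then uT (p i) (x i) else 0)) := by
      intro x
      rw [Fintype.prod_eq_mul_prod_subtype_ne (fun k => ∏ i, wb (p i) ((e.symm (x, X')) k i)) j]
      simp only [hj, hk, hYy, acc_eq]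
      rw [Finset.mul_sum, Real.exp_sum, Finset.prod_mul_distrib]
      ring
    rw [Finset.sum_congr rfl (fun x _ => this x), ← Finset.mul_sum]
    rw [sum_prod_pi (fun i b => wb (p i) b * Real.exp (α * if Y X' i then uT (p i) b else 0))]
    apply mul_le_mul_of_nonneg_left
    · calc _ ≤ ∏ i : Fin m, (1 + α^2) := by
            apply Finset.prod_le_prod
            · intro i _
              exact Finset.sum_nonneg fun b _ => mul_nonneg (wb_nonneg h0 (hp i) b) (Real.exp_pos _).le
            · intro i _
              exact sound_single h0 h1 hα hαt (hp i) _
        _ = _ := by simp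
    · exact Finset.prod_nonneg fun k _ => Finset.prod_nonneg fun i _ => wb_nonneg h0 (hp i) _
  refine (Finset.sum_le_sum fun X' _ => inner X').trans ?_
  rw [← Finset.sum_mul, sum_W_one, one_mul]

lemma Wt_ofReal (n m : ℕ) {t : ℝ} (h0 : 0 < t) (p : Fin m → ℝ) (hp : ∀ i, p i ∈ Set.Icc t (1-t)) (X : Fin n → Fin m → Bool) :
    Wt n m p X = ENNReal.ofReal (∏ k, ∏ i, wb (p i) (X k i)) := by
  unfold Wt
  rw [ENNReal.ofReal_prod_of_nonneg (fun k _ => Finset.prod_nonneg fun i _ => wb_nonneg h0 (hp i) _)]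
  apply Finset.prod_congr rfl
  intro k _
  rw [ENNReal.ofReal_prod_of_nonneg (fun i _ => wb_nonneg h0 (hp i) _)]

lemma sum_ofReal (n m : ℕ) {t : ℝ} (h0 : 0 < t) (p : Fin m → ℝ) (hp : ∀ i, p i ∈ Set.Icc t (1-t)) 
    (G : (Fin n → Fin m → Bool) → ℝ) (hG : ∀ X, 0 ≤ G X) : 
    ∑ X, Wt n m p X * ENNReal.ofReal (G X) = ENNReal.ofReal (∑ X, (∏ k, ∏ i, wb (p i) (X k i)) * G X) := by
  have hW : ∀ X : Fin n → Fin m → Bool, 0 ≤ ∏ k, ∏ i, wb (p i) (X k i) := fun X =>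
    Finset.prod_nonneg fun k _ => Finset.prod_nonneg fun i _ => wb_nonneg h0 (hp i) _
  rw [ENNReal.ofReal_sum_of_nonneg (fun X _ => mul_nonneg (hW X) (hG X))]
  apply Finset.sum_congr rfl
  intro X _
  rw [Wt_ofReal n m h0 p hp, ENNReal.ofReal_mul (hW X)]

lemma sound_lint (n m : ℕ) {t α : ℝ} (h0 : 0 < t) (h1 : t < 1/2) (hα : 0 ≤ α) (hαt : α ≤ 1.7 * Real.sqrt t)
    (j : Fin n) (y : (Fin n → Fin m → Bool) → Fin m → Bool)
    (hy : ∀ X X', (∀ k, k ≠ j → X k = X' k) → y X = y X') :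
    ∫⁻ p, ∑ X, Wt n m p X * ENNReal.ofReal (Real.exp (α * accusation m g1T g0T p (X j) (y X))) 
      ∂(Measure.pi fun _ : Fin m => biasMeasure (fT t)) ≤ ENNReal.ofReal ((1 + α^2)^m) := by
  have := bias_prob t h0 h1
  calc _ ≤ ∫⁻ p, ENNReal.ofReal ((1 + α^2)^m) ∂(Measure.pi fun _ : Fin m => biasMeasure (fT t)) := by
        apply lintegral_mono_ae
        filter_upwards [pi_ae t m] with p hp
        rw [sum_ofReal n m h0 p hp _ (fun X => (Real.exp_pos _).le)]
        exact ENNReal.ofReal_le_ofReal (sound_real n m h0 h1 hα hαt p hp j y hy)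
    _ = _ := by simp

/-- number of ones -/
def cnt {κ : Type*} [Fintype κ] (a : κ → Bool) : ℕ := (Finset.univ.filter (fun k => a k = true)).card

lemma cnt_le {κ : Type*} [Fintype κ] (a : κ → Bool) : cnt a ≤ Fintype.card κ := Finset.card_filter_le _ _

lemma sum_cnt {κ : Type*} [Fintype κ] [DecidableEq κ] (φ : ℕ → ℝ) :
    ∑ a : κ → Bool, φ (cnt a) = ∑ x ∈ Finset.range (Fintype.card κ + 1), ((Fintype.card κ).choose x : ℝ) * φ x := by
  have h := Finset.sum_powerset_apply_card φ (x := (Finset.univ : Finset κ))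
  simp only [nsmul_eq_mul, Finset.card_univ, Finset.powerset_univ] at h
  rw [← h]
  refine Finset.sum_bij' (fun a _ => Finset.univ.filter (fun k => a k = true)) (fun s _ => fun k => decide (k ∈ s)) ?_ ?_ ?_ ?_ ?_
  · intros; simp
  · intros; simp
  · intro a _; ext k; simp
  · intro s _; ext k; simp
  · intros; rfl

lemma prod_wb {κ : Type*} [Fintype κ] (a : κ → Bool) (p : ℝ) : 
    ∏ k, wb p (a k) = wt (Fintype.card κ) (cnt a) p := by
  unfold wb wt cnt
  rw [Finset.prod_ite]
  simp only [Finset.prod_const]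
  congr 2
  have := Finset.card_filter_add_card_filter_not (s := (Finset.univ : Finset κ)) (fun k => a k = true)
  rw [Finset.card_univ] at this
  omega

lemma sum_uT {κ : Type*} [Fintype κ] (a : κ → Bool) {p : ℝ} (hp0 : 0 < p) (hp1 : p < 1) : 
    ∑ k, uT p (a k) = U (Fintype.card κ) (cnt a) p := by
  simp only [uT_eq hp0 hp1, ← Finset.sum_div, Finset.sum_sub_distrib]
  unfold U cnt
  congr 2
  · simp
  · simp

/-- column weight -/
def Gc (β : ℝ) (c x : ℕ) (y : Bool) (p : ℝ) : ℝ :=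
  wt c x p * Real.exp (-(β * if y then U c x p else 0))

lemma Gc_meas (β : ℝ) (c x : ℕ) (y : Bool) : Measurable (Gc β c x y) := by
  have h1 : Measurable (wt c x) := (wt_cont c x).measurable
  have h2 : Measurable (U c x) := by unfold U; fun_prop
  unfold Gc
  cases y
  · simpa using h1
  · simp only [if_true]; fun_prop

lemma Gc_lint (t β : ℝ) (h0 : 0 < t) (h1 : t < 1/2) (hβ : 0 ≤ β) (c x : ℕ) (hx : x ≤ c) (y : Bool) 
    (hy0 : x = 0 → y = false) (hy1 : x = c → y = true) : 
    ∫⁻ p, ENNReal.ofReal (Gc β c x y p) ∂(biasMeasure (fT t)) ≤ ENNReal.ofReal (Kx t β c x) := by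
  cases y
  · have hlt : x < c := lt_of_le_of_ne hx (fun h => by simpa using hy1 h)
    have e : Gc β c x false = wt c x := by ext p; simp [Gc]
    rw [e, lint_bias t h0 h1 _ (wt_cont c x).measurable (wt_cont c x).continuousOn (fun p hp => wt_nonneg c x h0 hp)]
    exact ENNReal.ofReal_le_ofReal (Kx_y0 t β h0 h1 hβ c x hlt)
  · have hlt : 0 < x := Nat.pos_of_ne_zero (fun h => by simpa using hy0 h)
    have e : Gc β c x true = fun p => wt c x p * Real.exp (-(β * U c x p)) := by ext p; simp [Gc]
    have hm := Gc_meas β c x true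
    rw [e] at hm ⊢
    rw [lint_bias t h0 h1 _ hm (wexp_cont t β c x h0) 
      (fun p hp => mul_nonneg (wt_nonneg c x h0 hp) (Real.exp_pos _).le)]
    exact ENNReal.ofReal_le_ofReal (Kx_y1 t β h0 h1 hβ c x hlt hx)

lemma Kx_nonneg (t β : ℝ) (h0 : 0 < t) (h1 : t < 1/2) (hβ : 0 ≤ β) (c x : ℕ) (hc : 1 ≤ c) (hx : x ≤ c) :
    0 ≤ Kx t β c x := by
  rcases hx.lt_or_eq with h | h
  · exact (J_nonneg t h0 h1 _ (fun p hp => wt_nonneg c x h0 hp)).trans (Kx_y0 t β h0 h1 hβ c x h)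
  · exact (J_nonneg t h0 h1 _ (fun p hp => mul_nonneg (wt_nonneg c x h0 hp) (Real.exp_pos _).le)).trans 
      (Kx_y1 t β h0 h1 hβ c x (by omega) hx)

lemma compl_real (n m : ℕ) {t β : ℝ} (h0 : 0 < t) (C : Finset (Fin n))
    (p : Fin m → ℝ) (hp : ∀ i, p i ∈ Set.Icc t (1-t)) (y : (Fin n → Fin m → Bool) → Fin m → Bool)
    (Y : (C → Fin m → Bool) → Fin m → Bool)
    (hY : ∀ X, y X = Y (fun k => X k)) :
    ∑ X, (∏ k, ∏ i, wb (p i) (X k i)) * Real.exp (-(β * ∑ j ∈ C, accusation m g1T g0T p (X j) (y X))) =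
    ∑ a : C → Fin m → Bool, ∏ i, Gc β C.card (cnt (fun k => a k i)) (Y a i) (p i) := by
  set e := (Equiv.piEquivPiSubtypeProd (fun k => k ∈ C) (fun _ => Fin m → Bool)) with he
  have hk : ∀ z (k : {k // k ∈ C}), (e.symm z) k = z.1 k := by
    intro z k; simp [he]
  have hk' : ∀ z (k : {k // k ∉ C}), (e.symm z) k = z.2 k := by
    intro z k; simp [he, k.2]
  rw [← Equiv.sum_comp e.symm, Fintype.sum_prod_type]
  apply Finset.sum_congr rfl
  intro a _
  have step : ∀ b, (∏ k, ∏ i, wb (p i) (e.symm (a, b) k i)) * 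
       Real.exp (-(β * ∑ j ∈ C, accusation m g1T g0T p (e.symm (a,b) j) (y (e.symm (a,b))))) = 
       (∏ i, Gc β C.card (cnt (fun k => a k i)) (Y a i) (p i)) * ∏ k, ∏ i, wb (p i) (b k i) := by
    intro b
    have hyY : y (e.symm (a,b)) = Y a := by
      rw [hY]; congr 1; ext k : 1; exact hk (a,b) k
    rw [hyY, ← Fintype.prod_subtype_mul_prod_subtype (fun k => k ∈ C) (fun k => ∏ i, wb (p i) (e.symm (a, b) k i))]
    rw [← Finset.sum_coe_sort C (fun j => accusation m g1T g0T p (e.symm (a,b) j) (Y a))]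
    simp only [hk, hk']
    have h1 : (∏ k : {k // k ∈ C}, ∏ i, wb (p i) (a k i)) * Real.exp (-(β * ∑ j : C, accusation m g1T g0T p (a j) (Y a))) = 
       ∏ i, Gc β C.card (cnt (fun k => a k i)) (Y a i) (p i) := by
      rw [Finset.prod_comm]
      have h2 : -(β * ∑ j : C, accusation m g1T g0T p (a j) (Y a)) = 
          ∑ i, -(β * if Y a i then U C.card (cnt (fun k => a k i)) (p i) else 0) := by
        simp only [acc_eq]
        rw [Finset.sum_comm, Finset.mul_sum, ← Finset.sum_neg_distrib]
        apply Finset.sum_congr rfl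
        intro i _
        split_ifs
        · rw [sum_uT (fun k => a k i) (by linarith [(hp i).1]) (by linarith [(hp i).2])]
          simp
        · simp
      rw [h2, Real.exp_sum, ← Finset.prod_mul_distrib]
      apply Finset.prod_congr rfl
      intro i _
      have := prod_wb (fun k : C => a k i) (p i)
      rw [Fintype.card_coe] at this
      unfold Gc
      rw [← this]
    rw [← h1, mul_right_comm]
    congr!
  rw [Finset.sum_congr rfl (fun b _ => step b), ← Finset.mul_sum, sum_W_one, mul_one]

lemma compl_lint (n m : ℕ) {t β M : ℝ} (h0 : 0 < t) (h1 : t < 1/2) (hβ : 0 ≤ β) (C : Finset (Fin n)) (hC : 1 ≤ C.card)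
    (hM : ∑ x ∈ Finset.range (C.card+1), (C.card.choose x : ℝ) * Kx t β C.card x ≤ M)
    (y : (Fin n → Fin m → Bool) → Fin m → Bool)
    (hy : ∀ X X', (∀ k ∈ C, X k = X' k) → y X = y X')
    (hy1 : ∀ X i, (∀ j ∈ C, X j i = true) → y X i = true)
    (hy0 : ∀ X i, (∀ j ∈ C, X j i = false) → y X i = false) :
    ∫⁻ p, ∑ X, Wt n m p X * ENNReal.ofReal (Real.exp (-(β * ∑ j ∈ C, accusation m g1T g0T p (X j) (y X))))
      ∂(Measure.pi fun _ : Fin m => biasMeasure (fT t)) ≤ ENNReal.ofReal (M ^ m) := by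
  classical
  set extd : (C → Fin m → Bool) → (Fin n → Fin m → Bool) := fun a k => if h : k ∈ C then a ⟨k, h⟩ else fun _ => false with hext
  have hexta : ∀ a (k : Fin n) (h : k ∈ C), extd a k = a ⟨k, h⟩ := by
    intro a k h; simp [hext, h]
  set Y : (C → Fin m → Bool) → Fin m → Bool := fun a => y (extd a) with hYd
  have hY : ∀ X, y X = Y (fun k => X k) := by
    intro X
    apply hy
    intro k hk
    exact (hexta (fun k => X k) k hk).symm
  have step : ∫⁻ p, ∑ X, Wt n m p X * ENNReal.ofReal (Real.exp (-(β * ∑ j ∈ C, accusation m g1T g0T p (X j) (y X))))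
      ∂(Measure.pi fun _ : Fin m => biasMeasure (fT t)) = 
     ∫⁻ p, ∑ a : C → Fin m → Bool, ∏ i, ENNReal.ofReal (Gc β C.card (cnt (fun k => a k i)) (Y a i) (p i)) 
       ∂(Measure.pi fun _ : Fin m => biasMeasure (fT t)) := by
    apply lintegral_congr_ae
    filter_upwards [pi_ae t m] with p hp
    have hG : ∀ c x b i, 0 ≤ Gc β c x b (p i) := fun c x b i => 
      mul_nonneg (wt_nonneg c x h0 (hp i)) (Real.exp_pos _).le
    rw [sum_ofReal n m h0 p hp _ (fun X => (Real.exp_pos _).le), compl_real n m h0 C p hp y Y hY]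
    rw [ENNReal.ofReal_sum_of_nonneg (fun a _ => Finset.prod_nonneg fun i _ => hG _ _ _ _)]
    apply Finset.sum_congr rfl
    intro a _
    rw [ENNReal.ofReal_prod_of_nonneg (fun i _ => hG _ _ _ _)]
  have hgm : ∀ (a : C → Fin m → Bool) i, Measurable (fun x => ENNReal.ofReal (Gc β C.card (cnt (fun k => a k i)) (Y a i) x)) :=
    fun a i => ENNReal.measurable_ofReal.comp (Gc_meas _ _ _ _)
  have hm2 : ∀ a : C → Fin m → Bool, Measurable (fun p : Fin m → ℝ =>
      ∏ i, ENNReal.ofReal (Gc β C.card (cnt (fun k => a k i)) (Y a i) (p i))) :=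
    fun a => Finset.measurable_fun_prod _ fun i _ => (hgm a i).comp (measurable_pi_apply i)
  rw [step, lintegral_finsetSum _ (fun a _ => hm2 a)]
  have hcard : Fintype.card C = C.card := Fintype.card_coe C
  have hcl : ∀ b : C → Bool, cnt b ≤ C.card := fun b => hcard ▸ cnt_le b
  calc _ ≤ ∑ a : C → Fin m → Bool, ∏ i, ENNReal.ofReal (Kx t β C.card (cnt (fun k => a k i))) := by
        apply Finset.sum_le_sum
        intro a _
        rw [pi_prod_lint t h0 h1 m _ (hgm a)]
        apply Finset.prod_le_prod'
        intro i _
        apply Gc_lint t β h0 h1 hβ _ _ (hcl _)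
        · intro h
          apply hy0
          intro j hj
          rw [hexta a j hj]
          simp only [cnt, Finset.card_eq_zero, Finset.filter_eq_empty_iff, Finset.mem_univ, true_implies] at h
          simpa using @h ⟨j, hj⟩
        · intro h
          apply hy1
          intro j hj
          rw [hexta a j hj]
          rw [← hcard, ← Finset.card_univ, cnt, Finset.card_filter_eq_iff] at h
          exact h _ (Finset.mem_univ _)
    _ = ∑ a : Fin m → C → Bool, ∏ i, ENNReal.ofReal (Kx t β C.card (cnt (a i))) := by
        exact Equiv.sum_comp (Equiv.piComm (fun (_ : C) (_ : Fin m) => Bool)) 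
          (fun a : Fin m → C → Bool => ∏ i, ENNReal.ofReal (Kx t β C.card (cnt (a i))))
    _ = ∏ i : Fin m, ∑ b : C → Bool, ENNReal.ofReal (Kx t β C.card (cnt b)) := by
        rw [sum_prod_pi (fun (_ : Fin m) (b : C → Bool) => ENNReal.ofReal (Kx t β C.card (cnt b)))]
    _ = (ENNReal.ofReal (∑ b : C → Bool, Kx t β C.card (cnt b))) ^ m := by
        rw [ENNReal.ofReal_sum_of_nonneg (fun b _ => Kx_nonneg t β h0 h1 hβ _ _ hC (hcl b))]
        simp
    _ ≤ (ENNReal.ofReal M) ^ m := by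
        gcongr
        rw [sum_cnt (κ := C) (fun x => Kx t β C.card x), hcard]
        exact hM
    _ = _ := by
        rw [ENNReal.ofReal_pow]
        refine le_trans ?_ hM
        apply Finset.sum_nonneg
        intro x hx
        exact mul_nonneg (by positivity) (Kx_nonneg t β h0 h1 hβ _ _ hC (by simpa [Nat.lt_succ_iff] using hx))

lemma g1T_meas : Measurable g1T := by unfold g1T; fun_prop
lemma g0T_meas : Measurable g0T := by unfold g0T; fun_prop

lemma acc_meas (n m : ℕ) {Ω' : Type} [MeasurableSpace Ω']
    (ρ : (Fin n → Fin m → Bool) → Ω' → (Fin m → Bool))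
    (hρ : Measurable (fun q : (Fin n → Fin m → Bool) × Ω' => ρ q.1 q.2)) (j : Fin n) :
    Measurable (fun q : ((Fin m → ℝ) × (Fin n → Fin m → Bool)) × Ω' =>
      accusation m g1T g0T q.1.1 (q.1.2 j) (ρ q.1.2 q.2)) := by
  unfold accusation
  apply Finset.measurable_fun_sum
  intro i _
  have h1 : Measurable (fun q : ((Fin m → ℝ) × (Fin n → Fin m → Bool)) × Ω' => ρ q.1.2 q.2 i) :=
    (measurable_pi_apply i).comp (hρ.comp ((measurable_snd.comp measurable_fst).prodMk measurable_snd))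
  have h2 : Measurable (fun q : ((Fin m → ℝ) × (Fin n → Fin m → Bool)) × Ω' => q.1.2 j i) :=
    (measurable_pi_apply i).comp ((measurable_pi_apply j).comp (measurable_snd.comp measurable_fst))
  have h3 : Measurable (fun q : ((Fin m → ℝ) × (Fin n → Fin m → Bool)) × Ω' => q.1.1 i) :=
    (measurable_pi_apply i).comp (measurable_fst.comp measurable_fst)
  refine Measurable.ite (h1 (measurableSet_singleton true)) ?_ measurable_const
  exact Measurable.ite (h2 (measurableSet_singleton true)) (g1T_meas.comp h3) (g0T_meas.comp h3)

lemma sound_prob (n m : ℕ) {t α Z : ℝ} (h0 : 0 < t) (h1 : t < 1/2) (hα : 0 ≤ α) (hαt : α ≤ 1.7 * √t)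
    (C : Finset (Fin n)) {Ω' : Type} [MeasurableSpace Ω'] (μ' : Measure Ω') [IsProbabilityMeasure μ']
    (ρ : (Fin n → Fin m → Bool) → Ω' → (Fin m → Bool))
    (hρ : Measurable (fun q : (Fin n → Fin m → Bool) × Ω' => ρ q.1 q.2))
    (hρC : ∀ X X' r, (∀ j ∈ C, X j = X' j) → ρ X r = ρ X' r) (j : Fin n) (hj : j ∉ C) :
    ((codeMeasure n m (fT t)).prod μ')
            {q | Z < accusation m g1T g0T q.1.1 (q.1.2 j) (ρ q.1.2 q.2)}
      ≤ ENNReal.ofReal (Real.exp (-(α * Z)) * (1+α^2)^m) := by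
  have hm := acc_meas n m ρ hρ j
  set G : ((Fin m → ℝ) × (Fin n → Fin m → Bool)) × Ω' → ENNReal := fun q =>
    ENNReal.ofReal (Real.exp (α * accusation m g1T g0T q.1.1 (q.1.2 j) (ρ q.1.2 q.2))) with hG
  have hGm : Measurable G := ENNReal.measurable_ofReal.comp (Real.measurable_exp.comp (hm.const_mul α))
  have hb : ∫⁻ q, G q ∂((codeMeasure n m (fT t)).prod μ') ≤ ENNReal.ofReal ((1+α^2)^m) := by
    apply master n m (fT t) _ _ G hGm
    intro r
    apply sound_lint n m h0 h1 hα hαt j (fun X => ρ X r)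
    intro X X' h
    apply hρC
    intro k hk
    exact h k (fun e => hj (e ▸ hk))
  have hF : Measurable (fun q => ENNReal.ofReal (Real.exp (-(α * Z))) * G q) := hGm.const_mul _
  calc _ ≤ ∫⁻ q, ENNReal.ofReal (Real.exp (-(α * Z))) * G q ∂((codeMeasure n m (fT t)).prod μ') := by
        apply meas_le_lintegral₀ hF.aemeasurable
        intro q hq
        simp only [Set.mem_ofPred_eq] at hq
        rw [hG, ← ENNReal.ofReal_mul (Real.exp_pos _).le, ← Real.exp_add, ENNReal.one_le_ofReal]
        apply Real.one_le_exp
        nlinarith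
    _ ≤ _ := by
        rw [lintegral_const_mul _ hGm, ENNReal.ofReal_mul (Real.exp_pos _).le]
        gcongr

lemma compl_prob (n m : ℕ) {t β M Z : ℝ} (c0 : ℕ) (h0 : 0 < t) (h1 : t < 1/2) (hβ : 0 ≤ β) (hZ : 0 ≤ Z)
    (C : Finset (Fin n)) (hC : 1 ≤ C.card) (hC0 : C.card ≤ c0)
    (hM : ∑ x ∈ Finset.range (C.card+1), (C.card.choose x : ℝ) * Kx t β C.card x ≤ M)
    {Ω' : Type} [MeasurableSpace Ω'] (μ' : Measure Ω') [IsProbabilityMeasure μ']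
    (ρ : (Fin n → Fin m → Bool) → Ω' → (Fin m → Bool))
    (hρ : Measurable (fun q : (Fin n → Fin m → Bool) × Ω' => ρ q.1 q.2))
    (hρC : ∀ X X' r, (∀ j ∈ C, X j = X' j) → ρ X r = ρ X' r)
    (hρ1 : ∀ X r i, (∀ j ∈ C, X j i = true) → ρ X r i = true)
    (hρ0 : ∀ X r i, (∀ j ∈ C, X j i = false) → ρ X r i = false) :
    ((codeMeasure n m (fT t)).prod μ')
            {q | ∀ j ∈ C, accusation m g1T g0T q.1.1 (q.1.2 j) (ρ q.1.2 q.2) ≤ Z}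
      ≤ ENNReal.ofReal (Real.exp (β * (c0 * Z)) * M^m) := by
  have hm : Measurable (fun q : ((Fin m → ℝ) × (Fin n → Fin m → Bool)) × Ω' =>
      ∑ j ∈ C, accusation m g1T g0T q.1.1 (q.1.2 j) (ρ q.1.2 q.2)) :=
    Finset.measurable_fun_sum _ fun j _ => acc_meas n m ρ hρ j
  set G : ((Fin m → ℝ) × (Fin n → Fin m → Bool)) × Ω' → ENNReal := fun q =>
    ENNReal.ofReal (Real.exp (-(β * ∑ j ∈ C, accusation m g1T g0T q.1.1 (q.1.2 j) (ρ q.1.2 q.2)))) with hG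
  have hGm : Measurable G := ENNReal.measurable_ofReal.comp (Real.measurable_exp.comp (hm.const_mul β).neg)
  have hb : ∫⁻ q, G q ∂((codeMeasure n m (fT t)).prod μ') ≤ ENNReal.ofReal (M^m) := by
    apply master n m (fT t) _ _ G hGm
    intro r
    exact compl_lint n m h0 h1 hβ C hC hM (fun X => ρ X r) (fun X X' h => hρC X X' r h)
      (fun X i h => hρ1 X r i h) (fun X i h => hρ0 X r i h)
  have hF : Measurable (fun q => ENNReal.ofReal (Real.exp (β * (c0 * Z))) * G q) := hGm.const_mul _
  calc _ ≤ ∫⁻ q, ENNReal.ofReal (Real.exp (β * (c0 * Z))) * G q ∂((codeMeasure n m (fT t)).prod μ') := by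
        apply meas_le_lintegral₀ hF.aemeasurable
        intro q hq
        simp only [Set.mem_ofPred_eq] at hq
        rw [hG, ← ENNReal.ofReal_mul (Real.exp_pos _).le, ← Real.exp_add, ENNReal.one_le_ofReal]
        apply Real.one_le_exp
        have e1 : ∑ j ∈ C, accusation m g1T g0T q.1.1 (q.1.2 j) (ρ q.1.2 q.2) ≤ c0 * Z := by
          refine (Finset.sum_le_card_nsmul _ _ Z hq).trans ?_
          rw [nsmul_eq_mul]
          gcongr
        nlinarith
    _ ≤ _ := by
        rw [lintegral_const_mul _ hGm, ENNReal.ofReal_mul (Real.exp_pos _).le]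
        gcongr


set_option maxHeartbeats 1000000 in
/-- Theorem 1 of the paper: with the parameters `t = τ/c0`,
`D`, `δ`, `ξ`, `A = 4π²(1+ξ)²/(1-δ)²`, `B = 4π(1+ξ)/(1-δ)`, code length
`m = A·c0²·⌈ln (1/ε1)⌉` and threshold `Z = B·c0·⌈ln (1/ε1)⌉`, the Tardos scheme with
`f = f^T`, `g1 = g1^T`, `g0 = g0^T` is `ε1`-sound and `(c0,ε2)`-complete: for every
coalition `C` of size at most `c0`, every admissible (possibly randomized) strategy `ρ`
satisfying the marking condition, every innocent user `j ∉ C` gets accused with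
probability `< ε1`, and the probability that no colluder is accused is `< ε2`. -/
theorem tardos_sound_and_complete
    (ε1 ε2 : ℝ) (hε1 : ε1 ∈ Set.Ioo (0:ℝ) 1) (hε2 : ε2 ∈ Set.Ioo (0:ℝ) 1)
    (c0 : ℕ) (hc0 : 2 ≤ c0)
    (τ ω : ℝ) (hτ : τ ∈ Set.Ioo (0:ℝ) (1/2)) (hω : ω ∈ Set.Ioo (0:ℝ) 1)
    (hωτ : ω ≤ 2 * Real.sqrt (τ * (c0:ℝ)))
    (t : ℝ) (ht : t = τ / (c0:ℝ))
    (hc0' : 1 / (τ * (3.4 * π) ^ 2) ≤ (c0:ℝ))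
    (D : ℝ) (hD : D = Real.exp 1 * (ω / 1.7) ^ 2) (hD1 : D < 1)
    (δ : ℝ)
    (hδ : δ = 2 * τ + π * ω + Real.exp 1.7 * (π * (c0:ℝ) / (ω * (1 - D))) *
        D ^ (τ + (1.7 * Real.sqrt τ / ω) * Real.sqrt ((c0:ℝ) - τ)))
    (hδ1 : δ < 1)
    (ξ : ℝ)
    (hξ : ξ = Real.sqrt (1 + ((1 - δ) / (π * ω * (c0:ℝ))) * (Real.log ε2 / Real.log ε1)) - 1)
    (A B : ℝ) (hA : A = 4 * π ^ 2 * (1 + ξ) ^ 2 / (1 - δ) ^ 2)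
    (hB : B = 4 * π * (1 + ξ) / (1 - δ))
    (m : ℕ) (hm : (m:ℝ) = A * (c0:ℝ) ^ 2 * (⌈Real.log (1/ε1)⌉ : ℝ))
    (Z : ℝ) (hZ : Z = B * (c0:ℝ) * (⌈Real.log (1/ε1)⌉ : ℝ))
    (n : ℕ) (hn : 1 ≤ n) :
    ∀ (C : Finset (Fin n)), C.card ≤ c0 →
    ∀ (Ω' : Type) [MeasurableSpace Ω'] (μ' : Measure Ω') [IsProbabilityMeasure μ'],
    ∀ (ρ : (Fin n → Fin m → Bool) → Ω' → (Fin m → Bool)),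
      Measurable (fun q : (Fin n → Fin m → Bool) × Ω' => ρ q.1 q.2) →
      (∀ X X' r, (∀ j ∈ C, X j = X' j) → ρ X r = ρ X' r) →
      (∀ X r i, (∀ j ∈ C, X j i = true) → ρ X r i = true) →
      (∀ X r i, (∀ j ∈ C, X j i = false) → ρ X r i = false) →
      (∀ j : Fin n, j ∉ C →
        ((codeMeasure n m (fT t)).prod μ')
            {q | Z < accusation m g1T g0T q.1.1 (q.1.2 j) (ρ q.1.2 q.2)}
          < ENNReal.ofReal ε1)
      ∧ ((codeMeasure n m (fT t)).prod μ')
            {q | ∀ j ∈ C, accusation m g1T g0T q.1.1 (q.1.2 j) (ρ q.1.2 q.2) ≤ Z}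
          < ENNReal.ofReal ε2 := by
  obtain ⟨he0, he1⟩ := hε1
  obtain ⟨hf0, hf1⟩ := hε2
  obtain ⟨hτ0, hτ1⟩ := hτ
  obtain ⟨hω0, hω1⟩ := hω
  intro C hCc Ω' _ μ' _ ρ hρ hρC hρ1 hρ0
  have hπ := Real.pi_pos
  have hc2 : (2:ℝ) ≤ c0 := by exact_mod_cast hc0
  have hcpos : (0:ℝ) < c0 := by linarith
  have hl1 : Real.log ε1 < 0 := Real.log_neg he0 he1
  have hl2 : Real.log ε2 < 0 := Real.log_neg hf0 hf1
  have hk0 : -Real.log ε1 ≤ (⌈Real.log (1/ε1)⌉ : ℝ) := by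
    refine le_trans (le_of_eq ?_) (Int.le_ceil _)
    rw [one_div, Real.log_inv]
  set k : ℝ := (⌈Real.log (1/ε1)⌉ : ℝ) with hkdef
  have hk : 0 < k := by linarith
  have hδ0 : 0 < 1 - δ := by linarith
  have hD0 : 0 < D := by rw [hD]; positivity
  have hδpos : 0 < δ := by
    have : 0 < 1 - D := by linarith
    rw [hδ]; positivity
  set v : ℝ := Real.log ε2 / Real.log ε1 with hv
  have hv0 : 0 < v := div_pos_of_neg_of_neg hl2 hl1
  set s : ℝ := 1 + ξ with hs
  have hs2 : s ^ 2 = 1 + ((1 - δ) / (π * ω * (c0:ℝ))) * v := by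
    rw [hs, hξ, add_sub_cancel, Real.sq_sqrt (by positivity)]
  have hs0 : 0 ≤ s := by rw [hs, hξ, add_sub_cancel]; positivity
  have hs1 : 1 < s := by
    have : 0 < ((1 - δ) / (π * ω * (c0:ℝ))) * v := by positivity
    nlinarith
  have hA0 : 0 < A := by rw [hA]; positivity
  have hB0 : 0 < B := by rw [hB]; positivity
  have hZ0 : 0 < Z := by rw [hZ]; positivity
  have hmR : (0:ℝ) < m := by rw [hm]; positivity
  have hm0 : 0 < m := by exact_mod_cast hmR
  have ht0 : 0 < t := by rw [ht]; positivity
  have ht1 : t < 1/2 := by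
    rw [ht, div_lt_iff₀ hcpos]; nlinarith
  constructor
  · intro j hj
    set α : ℝ := (1 - δ) / (2 * π * s * c0) with hα
    have hα0 : 0 < α := by positivity
    have hαt : α ≤ 1.7 * √t := by
      have h1 : α ≤ 1 / (2 * π * c0) := by
        rw [hα, div_le_div_iff₀ (by positivity) (by positivity)]
        have : 0 < 2 * π * c0 := by positivity
        calc (1 - δ) * (2 * π * c0) ≤ s * (2 * π * c0) := by
              apply mul_le_mul_of_nonneg_right _ this.le
              linarith
          _ = 1 * (2 * π * s * c0) := by ring
      refine h1.trans ?_
      have h2 : 1 / (3.4 * π * c0) ≤ √t := by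
        apply Real.le_sqrt_of_sq_le
        rw [ht, div_pow, one_pow, div_le_div_iff₀ (by positivity) hcpos]
        rw [div_le_iff₀ (by positivity)] at hc0'
        calc 1 * (c0:ℝ) ≤ (c0 * (τ * (3.4 * π) ^ 2)) * c0 := by gcongr
          _ = τ * (3.4 * π * c0) ^ 2 := by ring
      calc 1 / (2 * π * c0) = 1.7 * (1 / (3.4 * π * c0)) := by field_simp; norm_num
        _ ≤ _ := by gcongr
    refine (sound_prob n m ht0 ht1 hα0.le hαt C μ' ρ hρ hρC j hj).trans_lt ?_
    rw [ENNReal.ofReal_lt_ofReal_iff he0]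
    have e1 : (1 + α^2)^m < Real.exp (α^2 * m) := by
      rw [mul_comm, Real.exp_nat_mul]
      refine pow_lt_pow_left₀ ?_ (by positivity) hm0.ne'
      have := Real.add_one_lt_exp (x := α^2) (by positivity)
      linarith
    calc Real.exp (-(α * Z)) * (1 + α^2)^m < Real.exp (-(α * Z)) * Real.exp (α^2 * m) := by
          gcongr
      _ = Real.exp (-k) := by
          rw [← Real.exp_add]
          congr 1
          rw [hZ, hm, hA, hB, hα]
          field_simp
          ring
      _ ≤ Real.exp (Real.log ε1) := by
          apply Real.exp_le_exp.mpr; linarith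
      _ = ε1 := Real.exp_log he0
  · obtain ⟨r⟩ : Nonempty Ω' := nonempty_of_isProbabilityMeasure μ'
    have hC1 : 1 ≤ C.card := by
      by_contra hcon
      have hCe : C = ∅ := by
        rw [← Finset.card_eq_zero]; omega
      subst hCe
      have a1 := hρ1 (fun _ _ => true) r ⟨0, hm0⟩ (by simp)
      have a0 := hρ0 (fun _ _ => true) r ⟨0, hm0⟩ (by simp)
      rw [a1] at a0
      exact absurd a0 (by simp)
    set β : ℝ := ω / c0 with hβ
    have hβ0 : 0 < β := by positivity
    have hM := Kx_sum c0 C.card hc0 hC1 hCc τ ω t D δ hτ0 hτ1 hω0 hω1 hωτ ht hD hD1 hδ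
    have hM' : ∑ x ∈ Finset.range (C.card+1), (C.card.choose x : ℝ) * Kx t β C.card x
        ≤ Real.exp (-(β * (1 - δ) / π)) := by
      refine hM.trans ?_
      have := Real.add_one_le_exp (-(β * (1 - δ) / π))
      linarith
    refine (compl_prob n m c0 ht0 ht1 hβ0.le hZ0.le C hC1 hCc hM' μ' ρ hρ hρC hρ1 hρ0).trans_lt ?_
    rw [ENNReal.ofReal_lt_ofReal_iff hf0, ← Real.exp_nat_mul, ← Real.exp_add]
    have e0 : β * (c0 * Z) + m * -(β * (1 - δ) / π) = -(4 * π * ω * c0 * k * (s * (s - 1)) / (1 - δ)) := by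
      rw [hZ, hm, hA, hB, hβ]
      field_simp
      ring
    have e2 : (1 - δ) * v = (s ^ 2 - 1) * (π * ω * c0) := by
      rw [hs2]; field_simp; ring
    have e3 : 2 * k * v ≤ 4 * π * ω * c0 * k * (s * (s - 1)) / (1 - δ) := by
      rw [le_div_iff₀ hδ0]
      have : 2 * k * v * (1 - δ) = 2 * k * (π * ω * c0) * ((s - 1) * (s + 1)) := by
        rw [mul_assoc, mul_comm v, e2]; ring
      rw [this]
      have h5 : 0 < 2 * k * (π * ω * c0) * (s - 1) := by
        have : 0 < s - 1 := by linarith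
        positivity
      nlinarith
    have e4 : -Real.log ε2 ≤ k * v := by
      calc -Real.log ε2 = (-Real.log ε1) * v := by
            have hne := hl1.ne
            rw [hv]; field_simp
        _ ≤ k * v := by gcongr
    calc _ < Real.exp (Real.log ε2) := by
          apply Real.exp_lt_exp.mpr
          rw [e0]; linarith
      _ = ε2 := Real.exp_log hf0

end
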